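/- arXiv:0801.2575 — 2 statements merged into one kernel-verified Lean document; each statement's English description precedes it below -/
import Mathlib

section
/- Let T be a simple type generated from a single base type variable X by implication →. The η-expanded β-normal closed λ-terms of type T are in bijection with the finite live strategies on the P-backtracking game 𝒫G(Δ_T). -/
namespace Hypergames

/-! Generic transition systems, games, dialogues and strategies. -/

/-- The state reached from `q` by following the labels `ls` (if defined). -/
def reach {Q L : Type} (tr : Q → L → Option Q) : Q → List L → Option Q
  | q, [] => some q
  | q, l :: ls => (tr q l).bind fun q' => reach tr q' ls

/-- The game (set of traces) of a transition system with transition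
function `tr` and initial state `star`. -/
def gameOf {Q L : Type} (tr : Q → L → Option Q) (star : Q) : Set (List L) :=
  { ls | (reach tr star ls).isSome }

/-- A set of `M`-traces is a game if it contains the empty trace and the
predecessor of each of its nonempty members. -/
def IsGame {M : Type} (G : Set (List M)) : Prop :=
  [] ∈ G ∧ ∀ p ∈ G, p ≠ [] → p.dropLast ∈ G

/-- The pointer of the `j`-th element (1-indexed) of a dialogue. -/
def pointer {M : Type} (d : List (ℕ × M)) (j : ℕ) : Option ℕ :=
  (d[j-1]?).map Prod.fst

/-- A dialogue over `M`: an `(ℕ × M)`-trace `⟨α₁,m₁⟩…⟨α_k,m_k⟩` such that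
`i - αᵢ ∈ {1,3,5,…}` for each `i`. -/
def IsDialogue {M : Type} (d : List (ℕ × M)) : Prop :=
  ∀ j, 1 ≤ j → j ≤ d.length → ∀ α, pointer d j = some α → α < j ∧ Odd (j - α)

/-- A chain of (1-indexed) positions `d₁ < d₂ < ⋯ < dₙ` of the dialogue `d`
with `α_{d₁} = 0` and `α_{d_j} = d_{j-1}`; such a chain determines a thread. -/
def IsChain {M : Type} (d : List (ℕ × M)) (ds : List ℕ) : Prop :=
  (∀ j ∈ ds, 1 ≤ j ∧ j ≤ d.length) ∧
  (∀ j, ds.head? = some j → pointer d j = some 0) ∧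
  List.Chain' (fun a b => pointer d b = some a) ds ∧
  List.Chain' (· < ·) ds

/-- The thread (sequence of moves) along a chain of positions. -/
def threadOf {M : Type} (d : List (ℕ × M)) (ds : List ℕ) : List M :=
  ds.filterMap fun j => (d[j-1]?).map Prod.snd

/-- A dialogue respects `G` if all its threads are in `G`. -/
def Respects {M : Type} (G : Set (List M)) (d : List (ℕ × M)) : Prop :=
  ∀ ds, IsChain d ds → threadOf d ds ∈ G

/-- The backtracking game `ℬG`: all dialogues over `M` respecting `G`. -/
def BG {M : Type} (G : Set (List M)) : Set (List (ℕ × M)) :=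
  { d | IsDialogue d ∧ Respects G d }

/-- The `P`-backtracking game `𝒫G`: dialogues of `ℬG` in which every
odd-indexed move points to the immediately preceding move. -/
def PG {M : Type} (G : Set (List M)) : Set (List (ℕ × M)) :=
  { d | d ∈ BG G ∧ ∀ j, Odd j → j ≤ d.length → pointer d j = some (j - 1) }

/-- A strategy (for the second player `P`) on a game `G`. -/
def IsStrategy {M : Type} (G σ : Set (List M)) : Prop :=
  σ ⊆ G ∧ IsGame σ ∧ ∀ p ∈ σ, Odd p.length → ∃! m, p ++ [m] ∈ σ

/-- A strategy is live if it responds to every stimulus. -/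
def Live {M : Type} (G σ : Set (List M)) : Prop :=
  ∀ p ∈ σ, Even p.length → ∀ m, p ++ [m] ∈ G → p ++ [m] ∈ σ

/-- The thread ending at position `j` (1-indexed), computed by following
pointers backwards, with explicit fuel (use fuel `j`). -/
def threadTo {M : Type} (d : List (ℕ × M)) : ℕ → ℕ → List M
  | 0, _ => []
  | fuel + 1, j =>
    match d[j-1]? with
    | none => []
    | some (α, m) => if α = 0 then [m] else threadTo d fuel α ++ [m]

/-! Simple types over a set `V` of type variables, and their games. -/

/-- Simple types generated from type variables by implication `→`. -/
inductive Ty (V : Type) : Type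
  | var : V → Ty V
  | arrow : Ty V → Ty V → Ty V

/-- The branches `T₁,…,Tₙ` of a type `T₁→…→Tₙ→X`. -/
def Ty.branches {V : Type} : Ty V → List (Ty V)
  | .var _ => []
  | .arrow A B => A :: Ty.branches B

/-- The rightmost (head) variable `X` of a type `T₁→…→Tₙ→X`. -/
def Ty.headVar {V : Type} : Ty V → V
  | .var X => X
  | .arrow _ B => Ty.headVar B

/-- The transition function of the transition system `Δ_T`: states are
simple types together with an initial state `⋆` (here `none`), labels are
positive integers (branch choices), with transitions `⋆ →¹ T` and
`(T₁→…→Tₙ→X) →ⁱ Tᵢ` for `1 ≤ i ≤ n`. -/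
def tyTrans {V : Type} (T : Ty V) : Option (Ty V) → ℕ → Option (Option (Ty V))
  | none, i => if i = 1 then some (some T) else none
  | some S, i => if 1 ≤ i then (S.branches[i-1]?).map some else none

/-- The colour of the move at (1-indexed) position `j` of a dialogue on the
game of `Δ_T`: the rightmost variable of the target state of the associated
transition, i.e. of the state reached along the thread ending at `j`. -/
def colourAt {V : Type} (T : Ty V) (d : List (ℕ × ℕ)) (j : ℕ) : Option V :=
  match reach (tyTrans T) none (threadTo d j j) with
  | some (some S) => some S.headVar
  | _ => none

/-- The copycat condition for a dialogue in `𝒫G(Δ_T)`: the colour of every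
even-indexed (`P`) move equals the colour of the immediately preceding move. -/
def CopycatDialogue {V : Type} (T : Ty V) (d : List (ℕ × ℕ)) : Prop :=
  ∀ j, Even j → 2 ≤ j → j ≤ d.length → colourAt T d j = colourAt T d (j - 1)

/-- A strategy satisfies the copycat condition if all its traces do. -/
def CopycatStrategy {V : Type} (T : Ty V) (σ : Set (List (ℕ × ℕ))) : Prop :=
  ∀ d ∈ σ, CopycatDialogue T d

/-- η-expanded β-normal terms of type `T` in context `Γ` (variables in de
Bruijn style: an index into the context): such a term is
`λx₁^{T₁}…λxₙ^{Tₙ}. y N₁ … N_m` where `T = T₁→…→Tₙ→X`, `y` is a variable of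
type `U₁→…→U_m→X` among the context extended by `x₁,…,xₙ`, and each `N_j` is
η-expanded β-normal of type `U_j` in the extended context. -/
inductive NF (V : Type) : List (Ty V) → Ty V → Type
  | mk (Γ : List (Ty V)) (T : Ty V)
      (k : Fin (Γ ++ T.branches).length)
      (hhead : ((Γ ++ T.branches).get k).headVar = T.headVar)
      (args : (j : Fin ((Γ ++ T.branches).get k).branches.length) →
        NF V (Γ ++ T.branches) (((Γ ++ T.branches).get k).branches.get j)) :
      NF V Γ T

/-! Dialogues annotated with the states reached by their threads. -/

theorem reach_append_singleton {Q L : Type} (tr : Q → L → Option Q) (q : Q) (ls : List L) (l : L) :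
    reach tr q (ls ++ [l]) = (reach tr q ls).bind fun q' => tr q' l := by
  induction ls generalizing q with
  | nil => simp [reach]
  | cons a ls ih => simp [reach, ih, Option.bind_assoc]

/-- Position of the last element of a chain, with `0` for the empty chain. -/
def chainEnd (ds : List ℕ) : ℕ := ds.getLast?.getD 0

set_option linter.deprecated false in
theorem isChain_nil {M : Type} (d : List (ℕ × M)) : IsChain d [] := by
  simp [IsChain, List.Chain']

set_option linter.deprecated false in
theorem isChain_append_singleton {M : Type} (d : List (ℕ × M)) (ds : List ℕ) (j : ℕ) :
    IsChain d (ds ++ [j]) ↔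
      IsChain d ds ∧ j ≤ d.length ∧ pointer d j = some (chainEnd ds) ∧ chainEnd ds < j := by
  unfold IsChain List.Chain' chainEnd
  rcases List.eq_nil_or_concat ds with rfl | ⟨ds, i, rfl⟩
  · simp
    tauto
  · have hh : (ds ++ [i] ++ [j]).head? = (ds ++ [i]).head? := by cases ds <;> rfl
    rw [List.concat_eq_append, hh, List.isChain_append (l₂ := [j]), List.isChain_append (l₂ := [j])]
    simp only [List.forall_mem_append, List.forall_mem_singleton, List.isChain_singleton,
      List.getLast?_concat, List.head?_cons, Option.mem_some_iff, forall_eq', Option.getD_some,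
      true_and]
    constructor
    · tauto
    · rintro ⟨h1, h2, h3, h4⟩
      exact ⟨⟨h1.1, by omega, h2⟩, h1.2.1, ⟨h1.2.2.1, h3⟩, h1.2.2.2, h4⟩

theorem IsChain.append_right {M : Type} {d : List (ℕ × M)} {ds : List ℕ} (h : IsChain d ds)
    (e : List (ℕ × M)) : IsChain (d ++ e) ds ∧ threadOf (d ++ e) ds = threadOf d ds := by
  induction ds using List.reverseRecOn with
  | nil => exact ⟨isChain_nil _, rfl⟩
  | append_singleton ds j ih =>
    rw [isChain_append_singleton] at h
    obtain ⟨h1, h2, h3, h4⟩ := h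
    obtain ⟨ih1, ih2⟩ := ih h1
    have hj : (d ++ e)[j-1]? = d[j-1]? := List.getElem?_append_left (by omega)
    refine ⟨(isChain_append_singleton _ _ _).2 ⟨ih1, by simp; omega, ?_, h4⟩, ?_⟩
    · simpa [pointer, hj] using h3
    · simp only [threadOf, List.filterMap_append] at ih2 ⊢
      rw [ih2]
      simp only [List.filterMap_cons, List.filterMap_nil, hj]

/-- `IsPlay tr star d ss` says that `d` is a dialogue of the P-backtracking game and that
`ss` lists the state `star` followed by the states reached along the threads ending at the
successive positions of `d`. -/
structure IsPlay {Q L : Type} (tr : Q → L → Option Q) (star : Q)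
    (d : List (ℕ × L)) (ss : List Q) : Prop where
  length : ss.length = d.length + 1
  init : ss[0]? = some star
  step : ∀ j α m, d[j]? = some (α, m) → α ≤ j ∧ Odd (j + 1 - α) ∧ (Even j → α = j) ∧
    ∃ s s', ss[α]? = some s ∧ ss[j+1]? = some s' ∧ tr s m = some s'

namespace IsPlay

variable {Q L : Type} {tr : Q → L → Option Q} {star : Q} {d : List (ℕ × L)} {ss : List Q}

theorem nil (tr : Q → L → Option Q) (star : Q) : IsPlay tr star [] [star] :=
  ⟨rfl, rfl, by simp⟩

theorem append_singleton (h : IsPlay tr star d ss) {α : ℕ} {m : L} {s' : Q} :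
    IsPlay tr star (d ++ [(α, m)]) (ss ++ [s']) ↔ α ≤ d.length ∧ Odd (d.length + 1 - α) ∧
      (Even d.length → α = d.length) ∧ ∃ s, ss[α]? = some s ∧ tr s m = some s' := by
  have hl := h.length
  constructor
  · intro h'
    obtain ⟨h1, h2, h3, s, t, h4, h5, h6⟩ := h'.step d.length α m (by simp)
    refine ⟨h1, h2, h3, s, ?_, ?_⟩
    · rwa [List.getElem?_append_left (by omega)] at h4
    · rw [← hl, List.getElem?_concat_length] at h5
      rw [h6, h5]
  · rintro ⟨h1, h2, h3, s, h4, h5⟩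
    refine ⟨by simp [hl], ?_, ?_⟩
    · rw [List.getElem?_append_left (by omega)]
      exact h.init
    · intro j β n hj
      rcases lt_trichotomy j d.length with hlt | rfl | hgt
      · rw [List.getElem?_append_left hlt] at hj
        obtain ⟨a1, a2, a3, s, t, a4, a5, a6⟩ := h.step j β n hj
        refine ⟨a1, a2, a3, s, t, ?_, ?_, a6⟩
        · rwa [List.getElem?_append_left (by omega)]
        · rwa [List.getElem?_append_left (by omega)]
      · simp only [List.getElem?_concat_length, Option.some.injEq, Prod.mk.injEq] at hj
        obtain ⟨rfl, rfl⟩ := hj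
        refine ⟨h1, h2, h3, s, s', ?_, ?_, h5⟩
        · rwa [List.getElem?_append_left (by omega)]
        · rw [← hl, List.getElem?_concat_length]
      · rw [List.getElem?_eq_none (by simp; omega)] at hj
        simp at hj

theorem reach_threadOf (h : IsPlay tr star d ss) {ds : List ℕ} (hc : IsChain d ds) :
    ∃ s, reach tr star (threadOf d ds) = some s ∧ ss[chainEnd ds]? = some s := by
  induction ds using List.reverseRecOn with
  | nil => exact ⟨star, rfl, h.init⟩
  | append_singleton ds j ih =>
    rw [isChain_append_singleton] at hc
    obtain ⟨h1, h2, h3, h4⟩ := hc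
    obtain ⟨s, hs, hs'⟩ := ih h1
    obtain ⟨i, rfl⟩ : ∃ i, j = i + 1 := ⟨j - 1, by omega⟩
    simp only [pointer, Nat.add_sub_cancel, Option.map_eq_some_iff, Prod.exists] at h3
    obtain ⟨α, m, hm, rfl⟩ := h3
    obtain ⟨-, -, -, t, t', ht, ht', htr⟩ := h.step i _ m hm
    rw [hs'] at ht
    cases ht
    refine ⟨t', ?_, by simpa [chainEnd] using ht'⟩
    have : threadOf d (ds ++ [i + 1]) = threadOf d ds ++ [m] := by simp [threadOf, hm]
    rw [this, reach_append_singleton, hs, Option.bind_some, htr]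

theorem exists_chain (h : IsPlay tr star d ss) (j : ℕ) (hj : j ≤ d.length) :
    ∃ ds, IsChain d ds ∧ chainEnd ds = j := by
  induction j using Nat.strong_induction_on with
  | _ j ih =>
    rcases j with _ | j
    · exact ⟨[], isChain_nil d, rfl⟩
    · obtain ⟨⟨α, m⟩, hm⟩ : ∃ x, d[j]? = some x := ⟨d[j], List.getElem?_eq_getElem hj⟩
      have hα := (h.step j α m hm).1
      obtain ⟨ds, hds, rfl⟩ := ih α (by omega) (by omega)
      exact ⟨ds ++ [j + 1], (isChain_append_singleton _ _ _).2
        ⟨hds, hj, by simp [pointer, hm], by omega⟩, by simp [chainEnd]⟩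

theorem mem_PG (h : IsPlay tr star d ss) : d ∈ PG (gameOf tr star) := by
  refine ⟨⟨?_, ?_⟩, ?_⟩
  · rintro (_ | j) h1 h2 α hα
    · omega
    · simp only [pointer, Nat.add_sub_cancel, Option.map_eq_some_iff, Prod.exists] at hα
      obtain ⟨α, m, hm, rfl⟩ := hα
      obtain ⟨a1, a2, -⟩ := h.step j α m hm
      exact ⟨by simp; omega, a2⟩
  · intro ds hds
    obtain ⟨s, hs, -⟩ := h.reach_threadOf hds
    simp [gameOf, hs]
  · rintro (_ | j) h1 h2
    · simp at h1
    · have hm : d[j]? = some d[j] := List.getElem?_eq_getElem h2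
      obtain ⟨-, -, a3, -⟩ := h.step j d[j].1 d[j].2 hm
      simp only [pointer, Nat.add_sub_cancel, hm, Option.map_some]
      rw [a3 (by simpa [Nat.odd_add_one] using h1)]

theorem append_singleton_mem_PG (h : IsPlay tr star d ss) (x : ℕ × L) :
    d ++ [x] ∈ PG (gameOf tr star) ↔ ∃ s', IsPlay tr star (d ++ [x]) (ss ++ [s']) := by
  refine ⟨?_, fun ⟨s', h'⟩ => h'.mem_PG⟩
  obtain ⟨α, m⟩ := x
  rintro ⟨⟨h1, h2⟩, h3⟩
  have hp : pointer (d ++ [(α, m)]) (d.length + 1) = some α := by simp [pointer]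
  obtain ⟨a1, a2⟩ := h1 (d.length + 1) (by omega) (by simp) α hp
  obtain ⟨ds, hds, hend⟩ := h.exists_chain α (by omega)
  obtain ⟨hds', hth⟩ := hds.append_right [(α, m)]
  have hg := h2 (ds ++ [d.length + 1]) ((isChain_append_singleton _ _ _).2
    ⟨hds', by simp, by rw [hp, hend], by omega⟩)
  obtain ⟨s, hs, hs'⟩ := h.reach_threadOf hds
  have : threadOf (d ++ [(α, m)]) (ds ++ [d.length + 1]) = threadOf d ds ++ [m] := by
    rw [← hth]
    simp [threadOf]
  rw [this, gameOf, Set.mem_ofPred_eq, reach_append_singleton, hs, Option.bind_some,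
    Option.isSome_iff_exists] at hg
  obtain ⟨s', hg⟩ := hg
  refine ⟨s', h.append_singleton.2 ⟨by omega, a2, fun he => ?_, s, hend ▸ hs', hg⟩⟩
  have := h3 (d.length + 1) he.add_one (by simp)
  rw [hp] at this
  simpa using this

end IsPlay

/-! Finite live strategies relative to a position. -/

/-- `StratAt G p σ` says that `σ` is a finite live strategy on the set of continuations of the
position `p` in the game `G`. -/
structure StratAt {M : Type} (G : Set (List M)) (p : List M) (σ : Set (List M)) : Prop where
  nil_mem : [] ∈ σ
  init_mem : ∀ q m, q ++ [m] ∈ σ → q ∈ σ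
  append_mem : ∀ q ∈ σ, p ++ q ∈ G
  respond : ∀ q ∈ σ, Odd (p ++ q).length → ∃! m, q ++ [m] ∈ σ
  live : ∀ q ∈ σ, Even (p ++ q).length → ∀ m, p ++ (q ++ [m]) ∈ G → q ++ [m] ∈ σ
  finite : σ.Finite

theorem stratAt_nil_iff {M : Type} {G σ : Set (List M)} :
    StratAt G [] σ ↔ IsStrategy G σ ∧ Live G σ ∧ σ.Finite := by
  constructor
  · intro h
    refine ⟨⟨h.append_mem, ⟨h.nil_mem, fun p hp hne => ?_⟩, h.respond⟩, h.live, h.finite⟩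
    rw [← List.dropLast_append_getLast hne] at hp
    exact h.init_mem _ _ hp
  · rintro ⟨⟨h1, ⟨h2, h3⟩, h4⟩, h5, h6⟩
    exact ⟨h2, fun q m hq => by simpa using h3 _ hq (by simp), h1, h4, h5, h6⟩

namespace StratAt

variable {M : Type} {G : Set (List M)} {p : List M} {σ : Set (List M)}

theorem singleton_mem (h : StratAt G p σ) {m : M} {q : List M} (hq : m :: q ∈ σ) : [m] ∈ σ := by
  induction q using List.reverseRecOn with
  | nil => exact hq
  | append_singleton q a ih => exact ih (h.init_mem _ _ hq)

theorem after (h : StratAt G p σ) {m : M} (hm : [m] ∈ σ) :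
    StratAt G (p ++ [m]) {q | m :: q ∈ σ} where
  nil_mem := hm
  init_mem q a hq := h.init_mem (m :: q) a hq
  append_mem q hq := by simpa using h.append_mem _ hq
  respond q hq ho := h.respond (m :: q) hq (by simpa using ho)
  live q hq he a ha := h.live (m :: q) hq (by simpa using he) a (by simpa using ha)
  finite := h.finite.preimage (f := (m :: ·)) (List.cons_injective.injOn)

theorem of_after (hnil : [] ∈ σ) (hp : p ∈ G) (hhead : ∀ m q, m :: q ∈ σ → [m] ∈ σ)
    (hodd : Odd p.length → ∃! m, [m] ∈ σ) (heven : Even p.length → ∀ m, p ++ [m] ∈ G → [m] ∈ σ)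
    (hfin : {m | [m] ∈ σ}.Finite)
    (hafter : ∀ m, [m] ∈ σ → StratAt G (p ++ [m]) {q | m :: q ∈ σ}) : StratAt G p σ where
  nil_mem := hnil
  init_mem q a hq := by
    cases q with
    | nil => exact hnil
    | cons m q => exact (hafter m (hhead _ _ hq)).init_mem q a hq
  append_mem q hq := by
    cases q with
    | nil => simpa using hp
    | cons m q => simpa using (hafter m (hhead _ _ hq)).append_mem q hq
  respond q hq ho := by
    cases q with
    | nil => exact hodd (by simpa using ho)
    | cons m q => exact (hafter m (hhead _ _ hq)).respond q hq (by simpa using ho)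
  live q hq he a ha := by
    cases q with
    | nil => exact heven (by simpa using he) a ha
    | cons m q =>
      exact (hafter m (hhead _ _ hq)).live q hq (by simpa using he) a (by simpa using ha)
  finite := by
    refine ((Set.finite_singleton []).union
      (hfin.biUnion fun m hm => (hafter m hm).finite.image (m :: ·))).subset ?_
    rintro (_ | ⟨m, q⟩) hq
    · exact Or.inl rfl
    · exact Or.inr (Set.mem_biUnion (x := m) (hhead _ _ hq) ⟨q, hq, rfl⟩)

end StratAt

/-! The game of a simple type. -/

theorem tyTrans_some_eq {V : Type} {T R : Ty V} {i : ℕ} {s : Option (Ty V)} :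
    tyTrans T (some R) i = some s ↔ 1 ≤ i ∧ ∃ U, R.branches[i-1]? = some U ∧ s = some U := by
  by_cases hi : 1 ≤ i <;> simp [tyTrans, hi, eq_comm]

theorem tyTrans_ne_none {V : Type} {T : Ty V} {s : Option (Ty V)} {i : ℕ} :
    tyTrans T s i ≠ some none := by
  rcases s with _ | R
  · simp only [tyTrans]
    split <;> simp
  · simp [tyTrans_some_eq]

theorem IsPlay.exists_ty {V : Type} {T : Ty V} {d : List (ℕ × ℕ)} {ss : List (Option (Ty V))}
    (h : IsPlay (tyTrans T) none d ss) {j : ℕ} (hj : j ≠ 0) {s : Option (Ty V)}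
    (hs : ss[j]? = some s) : ∃ R, s = some R := by
  obtain ⟨j, rfl⟩ := Nat.exists_eq_succ_of_ne_zero hj
  have hlt : j < d.length := by
    have := (List.getElem?_eq_some_iff.1 hs).1
    have := h.length
    omega
  obtain ⟨-, -, -, s₀, s', -, h2, h3⟩ := h.step j d[j].1 d[j].2 (List.getElem?_eq_getElem hlt)
  rw [hs] at h2
  cases h2
  exact Option.ne_none_iff_exists'.1 fun hn => tyTrans_ne_none (hn ▸ h3)

/-- The moves naming the variables bound at position `n` of a dialogue, when the state reached
there has `k` branches. -/
def newVars (n k : ℕ) : List (ℕ × ℕ) := (List.range k).map fun i => (n, i + 1)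

@[simp] theorem length_newVars (n k : ℕ) : (newVars n k).length = k := by simp [newVars]

theorem mem_newVars {n k : ℕ} {v : ℕ × ℕ} (hv : v ∈ newVars n k) : v.1 = n := by
  simp only [newVars, List.mem_map] at hv
  obtain ⟨i, -, rfl⟩ := hv
  rfl

theorem nodup_newVars (n k : ℕ) : (newVars n k).Nodup :=
  List.nodup_range.map fun i j h => by simpa using h

theorem nodup_append_newVars {vs : List (ℕ × ℕ)} {n : ℕ} (h : vs.Nodup) (hlt : ∀ v ∈ vs, v.1 < n)
    (k : ℕ) : (vs ++ newVars n k).Nodup := by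
  refine h.append (nodup_newVars n k) fun v h1 h2 => ?_
  have := hlt v h1
  have := mem_newVars h2
  omega

theorem append_newVars_lt {vs : List (ℕ × ℕ)} {n : ℕ} (hlt : ∀ v ∈ vs, v.1 < n) (k : ℕ) :
    ∀ v ∈ vs ++ newVars n k, v.1 < n + 1 := by
  intro v hv
  rcases List.mem_append.1 hv with h | h
  · exact (hlt v h).trans (Nat.lt_succ_self n)
  · rw [mem_newVars h]
    exact Nat.lt_succ_self n

/-- `PAt T p ss Γ vs S` says that `p` is a position of `𝒫G(Δ_T)` with states `ss`, in which `P`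
is to move at state `S`, and that the variables of the context `Γ` of earlier bound variables are
named by the moves `vs`. -/
structure PAt {V : Type} (T : Ty V) (p : List (ℕ × ℕ)) (ss : List (Option (Ty V)))
    (Γ : List (Ty V)) (vs : List (ℕ × ℕ)) (S : Ty V) : Prop where
  play : IsPlay (tyTrans T) none p ss
  odd : Odd p.length
  last : ss[p.length]? = some (some S)
  length : vs.length = Γ.length
  nodup : vs.Nodup
  lt : ∀ v ∈ vs, v.1 < p.length
  var : ∀ (α i : ℕ) (U : Ty V), α < p.length →
    ((Odd α ∧ ∃ R, ss[α]? = some (some R) ∧ 1 ≤ i ∧ R.branches[i-1]? = some U) ↔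
      ∃ k : ℕ, vs[k]? = some (α, i) ∧ Γ[k]? = some U)

namespace PAt

variable {V : Type} {T : Ty V} {p : List (ℕ × ℕ)} {ss : List (Option (Ty V))}
  {Γ : List (Ty V)} {vs : List (ℕ × ℕ)} {S : Ty V}

theorem length_vars (h : PAt T p ss Γ vs S) :
    (vs ++ newVars p.length S.branches.length).length = (Γ ++ S.branches).length := by
  simp [h.length]

theorem nodup_vars (h : PAt T p ss Γ vs S) :
    (vs ++ newVars p.length S.branches.length).Nodup :=
  nodup_append_newVars h.nodup h.lt _

theorem lt_vars (h : PAt T p ss Γ vs S) :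
    ∀ v ∈ vs ++ newVars p.length S.branches.length, v.1 < p.length + 1 :=
  append_newVars_lt h.lt _

theorem var_vars (h : PAt T p ss Γ vs S) {α : ℕ} (i : ℕ) (U : Ty V) (hα : α ≤ p.length) :
    (Odd α ∧ ∃ R, ss[α]? = some (some R) ∧ 1 ≤ i ∧ R.branches[i-1]? = some U) ↔
      ∃ k : ℕ, (vs ++ newVars p.length S.branches.length)[k]? = some (α, i) ∧
        (Γ ++ S.branches)[k]? = some U := by
  rcases hα.lt_or_eq with hlt | rfl
  · rw [h.var α i U hlt]
    constructor
    · rintro ⟨k, h1, h2⟩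
      have hk := (List.getElem?_eq_some_iff.1 h1).1
      refine ⟨k, ?_, ?_⟩
      · rwa [List.getElem?_append_left hk]
      · rwa [List.getElem?_append_left (h.length ▸ hk)]
    · rintro ⟨k, h1, h2⟩
      by_cases hk : k < vs.length
      · rw [List.getElem?_append_left hk] at h1
        rw [List.getElem?_append_left (h.length ▸ hk)] at h2
        exact ⟨k, h1, h2⟩
      · rw [List.getElem?_append_right (by omega)] at h1
        have := mem_newVars (List.mem_of_getElem? h1)
        dsimp only at this
        omega
  · simp only [h.last, Option.some.injEq, h.odd, true_and, exists_eq_left']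
    constructor
    · rintro ⟨hi, hU⟩
      have hk := (List.getElem?_eq_some_iff.1 hU).1
      refine ⟨vs.length + (i - 1), ?_, ?_⟩
      · rw [List.getElem?_append_right (by omega)]
        simp only [newVars, List.getElem?_map, Nat.add_sub_cancel_left, List.getElem?_range hk,
          Option.map_some, Option.some.injEq, Prod.mk.injEq, true_and]
        omega
      · rw [h.length, List.getElem?_append_right (by omega), Nat.add_sub_cancel_left]
        exact hU
    · rintro ⟨k, h1, h2⟩
      by_cases hk : k < vs.length
      · rw [List.getElem?_append_left hk] at h1
        have := h.lt _ (List.mem_of_getElem? h1)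
        dsimp only at this
        omega
      · rw [List.getElem?_append_right (by omega)] at h1
        rw [List.getElem?_append_right (by have := h.length; omega), ← h.length] at h2
        simp only [newVars, List.getElem?_map, Option.map_eq_some_iff, Prod.mk.injEq, true_and,
          List.getElem?_eq_some_iff, List.getElem_range, List.length_range] at h1
        obtain ⟨a, ⟨-, h3⟩, rfl⟩ := h1
        subst h3
        exact ⟨by omega, h2⟩

theorem isPlay_append (h : PAt T p ss Γ vs S) {k : ℕ} {v : ℕ × ℕ} {U : Ty V}
    (hv : (vs ++ newVars p.length S.branches.length)[k]? = some v)
    (hU : (Γ ++ S.branches)[k]? = some U) :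
    IsPlay (tyTrans T) none (p ++ [v]) (ss ++ [some U]) := by
  obtain ⟨α, i⟩ := v
  have hα : α < p.length + 1 := h.lt_vars _ (List.mem_of_getElem? hv)
  obtain ⟨ho, R, hR, hi, hb⟩ := (h.var_vars i U (Nat.lt_succ_iff.1 hα)).2 ⟨k, hv, hU⟩
  refine h.play.append_singleton.2 ⟨by omega, ?_, ?_, some R, hR, ?_⟩
  · have := h.odd
    grind
  · intro he
    exact absurd h.odd (Nat.not_odd_iff_even.2 he)
  · exact tyTrans_some_eq.2 ⟨hi, U, hb, rfl⟩

theorem append_mem_PG (h : PAt T p ss Γ vs S) (v : ℕ × ℕ) :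
    p ++ [v] ∈ PG (gameOf (tyTrans T) none) ↔
      v ∈ vs ++ newVars p.length S.branches.length := by
  constructor
  · rw [h.play.append_singleton_mem_PG]
    rintro ⟨s', hs'⟩
    obtain ⟨α, i⟩ := v
    obtain ⟨h1, h2, -, s, h3, h4⟩ := h.play.append_singleton.1 hs'
    have hα : Odd α := by
      have := h.odd
      grind
    obtain ⟨R, rfl⟩ := h.play.exists_ty hα.pos.ne' h3
    obtain ⟨hi, U, hU, rfl⟩ := tyTrans_some_eq.1 h4
    obtain ⟨k, hk, -⟩ := (h.var_vars i U h1).1 ⟨hα, R, h3, hi, hU⟩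
    exact List.mem_of_getElem? hk
  · intro hv
    obtain ⟨k, hk, rfl⟩ := List.getElem_of_mem hv
    exact (h.isPlay_append (List.getElem?_eq_getElem hk)
      (List.getElem?_eq_getElem (h.length_vars ▸ hk))).mem_PG

theorem append_append_mem_PG (h : PAt T p ss Γ vs S) {k : ℕ} {v : ℕ × ℕ} {U : Ty V}
    (hv : (vs ++ newVars p.length S.branches.length)[k]? = some v)
    (hU : (Γ ++ S.branches)[k]? = some U) (o : ℕ × ℕ) :
    p ++ [v] ++ [o] ∈ PG (gameOf (tyTrans T) none) ↔
      ∃ j : Fin U.branches.length, o = (p.length + 1, j.1 + 1) := by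
  have hp := h.isPlay_append hv hU
  have hlast : (ss ++ [some U])[p.length + 1]? = some (some U) := by
    rw [← h.play.length, List.getElem?_concat_length]
  rw [hp.append_singleton_mem_PG]
  obtain ⟨α, i⟩ := o
  simp only [hp.append_singleton, List.length_append, List.length_singleton]
  constructor
  · rintro ⟨s', h1, h2, h3, s, h4, h5⟩
    obtain rfl := h3 h.odd.add_one
    rw [hlast] at h4
    cases h4
    obtain ⟨hi, W, hW, rfl⟩ := tyTrans_some_eq.1 h5
    refine ⟨⟨i - 1, (List.getElem?_eq_some_iff.1 hW).1⟩, ?_⟩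
    simp only [Prod.mk.injEq, true_and]
    omega
  · rintro ⟨j, hj⟩
    cases hj
    refine ⟨some U.branches[j], le_rfl, ?_, fun _ => rfl, some U, hlast, ?_⟩
    · simp
    · simp [tyTrans_some_eq]

theorem next (h : PAt T p ss Γ vs S) {k : ℕ} {v : ℕ × ℕ} {U : Ty V}
    (hv : (vs ++ newVars p.length S.branches.length)[k]? = some v)
    (hU : (Γ ++ S.branches)[k]? = some U) (j : Fin U.branches.length) :
    PAt T (p ++ [v] ++ [(p.length + 1, j.1 + 1)]) (ss ++ [some U] ++ [some (U.branches.get j)])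
      (Γ ++ S.branches) (vs ++ newVars p.length S.branches.length) (U.branches.get j) where
  play := by
    have hp := h.isPlay_append hv hU
    have hlast : (ss ++ [some U])[p.length + 1]? = some (some U) := by
      rw [← h.play.length, List.getElem?_concat_length]
    refine hp.append_singleton.2 ⟨by simp, by simp, by simp, some U, hlast, ?_⟩
    simp [tyTrans_some_eq]
  odd := by simpa using h.odd.add_even even_two
  last := by
    have : (p ++ [v] ++ [(p.length + 1, j.1 + 1)]).length = (ss ++ [some U]).length := by
      simp [h.play.length]
    rw [this, List.getElem?_concat_length]
  length := h.length_vars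
  nodup := h.nodup_vars
  lt w hw := (h.lt_vars w hw).trans (by simp)
  var α i W hα := by
    have hα' : α ≤ p.length + 1 := by simpa [Nat.lt_succ_iff] using hα
    rcases hα'.lt_or_eq with hlt | rfl
    · rw [← h.var_vars i W (Nat.lt_succ_iff.1 hlt), List.getElem?_append_left,
        List.getElem?_append_left]
      · rw [h.play.length]
        exact hlt
      · simp [h.play.length]
        omega
    · constructor
      · rintro ⟨ho, -⟩
        exact absurd h.odd.add_one (Nat.not_even_iff_odd.2 ho)
      · rintro ⟨k, hk, -⟩
        exact absurd (h.lt_vars _ (List.mem_of_getElem? hk)) (lt_irrefl _)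

end PAt

/-! From terms to strategies. -/

/-- The plays of the strategy of a term, as continuations of a position of length `n` in which the
variables of the context are named by the moves `vs`: `P` plays the head variable, then `O`
chooses one of its arguments. -/
def NF.plays {V : Type} : {Γ : List (Ty V)} → {S : Ty V} → NF V Γ S → ℕ → List (ℕ × ℕ) →
    Set (List (ℕ × ℕ))
  | _, _, .mk _ S k _ args, n, vs =>
    {q | match q with
      | [] => True
      | [v] => (vs ++ newVars n S.branches.length)[k.1]? = some v
      | v :: o :: q => (vs ++ newVars n S.branches.length)[k.1]? = some v ∧
          ∃ j, o = (n + 1, j.1 + 1) ∧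
            q ∈ (args j).plays (n + 2) (vs ++ newVars n S.branches.length)}

section

variable {V : Type} {Γ : List (Ty V)} {S : Ty V} (k : Fin (Γ ++ S.branches).length)
  (hhead : ((Γ ++ S.branches).get k).headVar = S.headVar)
  (args : (j : Fin ((Γ ++ S.branches).get k).branches.length) →
    NF V (Γ ++ S.branches) (((Γ ++ S.branches).get k).branches.get j))
  (n : ℕ) (vs : List (ℕ × ℕ))

theorem NF.nil_mem_plays_mk : [] ∈ (NF.mk Γ S k hhead args).plays n vs := by
  rw [NF.plays]
  trivial

theorem NF.singleton_mem_plays_mk (v : ℕ × ℕ) : [v] ∈ (NF.mk Γ S k hhead args).plays n vs ↔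
    (vs ++ newVars n S.branches.length)[k.1]? = some v := by
  rw [NF.plays]
  rfl

theorem NF.cons_cons_mem_plays_mk (v o : ℕ × ℕ) (q : List (ℕ × ℕ)) :
    v :: o :: q ∈ (NF.mk Γ S k hhead args).plays n vs ↔
      (vs ++ newVars n S.branches.length)[k.1]? = some v ∧ ∃ j, o = (n + 1, j.1 + 1) ∧
        q ∈ (args j).plays (n + 2) (vs ++ newVars n S.branches.length) := by
  rw [NF.plays]
  rfl

end

theorem NF.nil_mem_plays {V : Type} {Γ : List (Ty V)} {S : Ty V} (t : NF V Γ S) (n : ℕ)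
    (vs : List (ℕ × ℕ)) : [] ∈ t.plays n vs := by
  cases t
  exact NF.nil_mem_plays_mk ..

theorem NF.plays_injective {V : Type} {Γ : List (Ty V)} {S : Ty V} (t t' : NF V Γ S) (n : ℕ)
    (vs : List (ℕ × ℕ)) (hlen : vs.length = Γ.length) (hnd : vs.Nodup) (hlt : ∀ v ∈ vs, v.1 < n)
    (h : t.plays n vs = t'.plays n vs) : t = t' := by
  induction t generalizing n vs with
  | mk Γ S k hhead args ih =>
    obtain ⟨_, _, k', hhead', args'⟩ := t'
    have hnd' := nodup_append_newVars hnd hlt S.branches.length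
    have hlt' := append_newVars_lt hlt S.branches.length
    have hlen' : (vs ++ newVars n S.branches.length).length = (Γ ++ S.branches).length := by
      simp [hlen]
    have hk : k.1 < (vs ++ newVars n S.branches.length).length := by
      rw [hlen']
      exact k.2
    have hv := List.getElem?_eq_getElem hk
    have hvk := (NF.singleton_mem_plays_mk k hhead args n vs _).2 hv
    rw [h, NF.singleton_mem_plays_mk, ← hv] at hvk
    obtain rfl : k = k' := Fin.ext ((List.getElem?_inj hk hnd').1 hvk.symm)
    congr 1
    funext j
    refine ih j (args' j) (n + 2) _ hlen' hnd' (fun v hv => (hlt' v hv).trans (by omega)) ?_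
    ext q
    have hq := Set.ext_iff.1 h
      ((vs ++ newVars n S.branches.length)[k.1] :: (n + 1, j.1 + 1) :: q)
    simpa [NF.cons_cons_mem_plays_mk, hv, ← Fin.ext_iff] using hq

theorem NF.stratAt_plays {V : Type} {T : Ty V} {Γ : List (Ty V)} {S : Ty V} (t : NF V Γ S)
    (p : List (ℕ × ℕ)) (ss : List (Option (Ty V))) (vs : List (ℕ × ℕ)) (h : PAt T p ss Γ vs S) :
    StratAt (PG (gameOf (tyTrans T) none)) p (t.plays p.length vs) := by
  induction t generalizing p ss vs with
  | mk Γ S k hhead args ih =>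
    have hk : k.1 < (vs ++ newVars p.length S.branches.length).length := by
      rw [h.length_vars]
      exact k.2
    have hv := List.getElem?_eq_getElem hk
    have hU : (Γ ++ S.branches)[k.1]? = some ((Γ ++ S.branches).get k) := by simp
    set v := (vs ++ newVars p.length S.branches.length)[k.1]
    have hmem (m : ℕ × ℕ) : [m] ∈ (NF.mk Γ S k hhead args).plays p.length vs ↔ v = m := by
      rw [NF.singleton_mem_plays_mk, hv, Option.some.injEq]
    refine StratAt.of_after (NF.nil_mem_plays _ _ _) h.play.mem_PG ?_ ?_ ?_ ?_ ?_
    · rintro m (_ | ⟨o, q⟩) hq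
      · exact hq
      · rw [NF.singleton_mem_plays_mk]
        exact ((NF.cons_cons_mem_plays_mk k hhead args _ _ _ _ _).1 hq).1
    · exact fun _ => ⟨v, (hmem v).2 rfl, fun m hm => ((hmem m).1 hm).symm⟩
    · exact fun he => absurd h.odd (Nat.not_odd_iff_even.2 he)
    · simp [hmem]
    · intro m hm
      obtain rfl := (hmem m).1 hm
      have hmem' (o : ℕ × ℕ) (q : List (ℕ × ℕ)) :
          o :: q ∈ {q | v :: q ∈ (NF.mk Γ S k hhead args).plays p.length vs} ↔
            ∃ j, o = (p.length + 1, j.1 + 1) ∧ q ∈ (args j).plays (p.length + 2)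
              (vs ++ newVars p.length S.branches.length) := by
        simp [NF.cons_cons_mem_plays_mk, hv, v]
      refine StratAt.of_after hm (h.isPlay_append hv hU).mem_PG ?_ ?_ ?_ ?_ ?_
      · intro o q hq
        obtain ⟨j, rfl, -⟩ := (hmem' _ _).1 hq
        exact (hmem' _ _).2 ⟨j, rfl, NF.nil_mem_plays _ _ _⟩
      · intro ho
        rw [List.length_append, List.length_singleton] at ho
        exact absurd h.odd.add_one (Nat.not_even_iff_odd.2 ho)
      · intro _ o ho
        obtain ⟨j, rfl⟩ := (h.append_append_mem_PG hv hU o).1 ho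
        exact (hmem' _ _).2 ⟨j, rfl, NF.nil_mem_plays _ _ _⟩
      · refine (Set.finite_range fun j : Fin ((Γ ++ S.branches).get k).branches.length =>
          (p.length + 1, j.1 + 1)).subset fun o ho => ?_
        obtain ⟨j, rfl, -⟩ := (hmem' _ _).1 ho
        exact ⟨j, rfl⟩
      · intro o ho
        obtain ⟨j, rfl, -⟩ := (hmem' _ _).1 ho
        have := ih j _ _ _ (h.next hv hU j)
        rw [List.length_append, List.length_append, List.length_singleton,
          List.length_singleton] at this
        convert this using 1
        ext q
        refine (hmem' _ _).trans ⟨?_, fun hq => ⟨j, rfl, hq⟩⟩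
        rintro ⟨j', hj', hq⟩
        obtain rfl : j = j' := by simpa [Fin.ext_iff] using hj'
        exact hq

theorem NF.exists_plays_eq {V : Type} [Subsingleton V] {T : Ty V} (N : ℕ) {Γ : List (Ty V)}
    {S : Ty V} {p : List (ℕ × ℕ)} {ss : List (Option (Ty V))} {vs : List (ℕ × ℕ)}
    {σ : Set (List (ℕ × ℕ))} (h : PAt T p ss Γ vs S)
    (hσ : StratAt (PG (gameOf (tyTrans T) none)) p σ) (hN : ∀ q ∈ σ, q.length < N) :
    ∃ t : NF V Γ S, t.plays p.length vs = σ := by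
  induction N generalizing Γ S p ss vs σ with
  | zero => exact absurd (hN _ hσ.nil_mem) (Nat.not_lt_zero _)
  | succ N ih =>
    obtain ⟨v, hvσ, hvu⟩ := hσ.respond [] hσ.nil_mem (by simpa using h.odd)
    obtain ⟨k, hk, hv⟩ := List.mem_iff_getElem.1
      ((h.append_mem_PG v).1 (hσ.append_mem _ hvσ))
    have hk' := h.length_vars ▸ hk
    replace hv : (vs ++ newVars p.length S.branches.length)[k]? = some v := by
      rw [List.getElem?_eq_getElem hk, hv]
    have hU : (Γ ++ S.branches)[k]? = some ((Γ ++ S.branches).get ⟨k, hk'⟩) := by simp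
    have hσv := hσ.after hvσ
    have hO (o : ℕ × ℕ) : [v, o] ∈ σ ↔
        ∃ j : Fin ((Γ ++ S.branches).get ⟨k, hk'⟩).branches.length,
          o = (p.length + 1, j.1 + 1) := by
      rw [← h.append_append_mem_PG hv hU]
      refine ⟨fun ho => by simpa using hσ.append_mem _ ho, fun ho => ?_⟩
      exact hσ.live [v] hvσ (by simpa using h.odd.add_one) o (by simpa using ho)
    have hargs (j : Fin ((Γ ++ S.branches).get ⟨k, hk'⟩).branches.length) :=
      ih (h.next hv hU j) (hσv.after ((hO _).2 ⟨j, rfl⟩)) fun q hq => by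
        have := hN _ hq
        simp only [List.length_cons] at this
        omega
    choose args hargs using hargs
    refine ⟨.mk Γ S ⟨k, hk'⟩ (Subsingleton.elim _ _) args, ?_⟩
    ext (_ | ⟨m, _ | ⟨o, q⟩⟩)
    · exact iff_of_true (NF.nil_mem_plays _ _ _) hσ.nil_mem
    · rw [NF.singleton_mem_plays_mk, hv, Option.some.injEq]
      exact ⟨fun hm => hm ▸ hvσ, fun hm => (hvu m hm).symm⟩
    · rw [NF.cons_cons_mem_plays_mk, hv, Option.some.injEq]
      have hplays (j) (q) : q ∈ (args j).plays (p.length + 2)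
          (vs ++ newVars p.length S.branches.length) ↔
            v :: (p.length + 1, j.1 + 1) :: q ∈ σ := by
        have := Set.ext_iff.1 (hargs j) q
        simpa using this
      constructor
      · rintro ⟨rfl, j, rfl, hq⟩
        exact (hplays j q).1 hq
      · intro hq
        obtain rfl := hvu m (hσ.singleton_mem hq)
        obtain ⟨j, rfl⟩ := (hO o).1 (hσv.singleton_mem hq)
        exact ⟨rfl, j, rfl, (hplays j q).2 hq⟩

/-- The strategy on `𝒫G(Δ_T)` of a closed term of type `T`. -/
def NF.strategy {V : Type} {T : Ty V} (t : NF V [] T) : Set (List (ℕ × ℕ)) :=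
  {q | match q with
    | [] => True
    | m :: q => m = (0, 1) ∧ q ∈ t.plays 1 []}

theorem singleton_mem_PG {V : Type} (T : Ty V) (m : ℕ × ℕ) :
    [m] ∈ PG (gameOf (tyTrans T) none) ↔ m = (0, 1) := by
  have h := IsPlay.nil (tyTrans T) none
  obtain ⟨α, i⟩ := m
  rw [← List.nil_append [(α, i)], h.append_singleton_mem_PG]
  simp only [h.append_singleton]
  constructor
  · rintro ⟨s', h1, -, -, s, h2, h3⟩
    obtain rfl : α = 0 := by simpa using h1
    obtain rfl : none = s := by simpa using h2
    by_cases hi : i = 1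
    · rw [hi]
    · simp [tyTrans, hi] at h3
  · intro hm
    cases hm
    exact ⟨some T, by simp, by simp, by simp, none, rfl, by simp [tyTrans]⟩

theorem pAt_start {V : Type} (T : Ty V) : PAt T [(0, 1)] [none, some T] [] [] T where
  play := (IsPlay.nil (tyTrans T) none).append_singleton.2
    ⟨by simp, by simp, by simp, none, rfl, by simp [tyTrans]⟩
  odd := by simp
  last := rfl
  length := rfl
  nodup := List.nodup_nil
  lt := by simp
  var α i U hα := by
    obtain rfl : α = 0 := by simpa using hα
    simp

theorem NF.stratAt_strategy {V : Type} {T : Ty V} (t : NF V [] T) :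
    StratAt (PG (gameOf (tyTrans T) none)) [] t.strategy := by
  have hmem (m : ℕ × ℕ) (q : List (ℕ × ℕ)) :
      m :: q ∈ t.strategy ↔ m = (0, 1) ∧ q ∈ t.plays 1 [] := Iff.rfl
  refine StratAt.of_after trivial (IsPlay.nil _ _).mem_PG ?_ (by simp) ?_ ?_ ?_
  · exact fun m q hq => ⟨hq.1, t.nil_mem_plays _ _⟩
  · exact fun _ m hm => ⟨(singleton_mem_PG T m).1 hm, t.nil_mem_plays _ _⟩
  · exact (Set.finite_singleton (0, 1)).subset fun m hm => hm.1
  · rintro m ⟨rfl, -⟩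
    simpa [hmem] using t.stratAt_plays _ _ _ (pAt_start T)

/-- Let `T` be a simple type generated from a single base
type variable `X` by implication `→` (we take `V = Unit`).  The η-expanded
β-normal closed λ-terms of type `T` are in bijection with the finite live
strategies on the `P`-backtracking game `𝒫G(Δ_T)`. -/
theorem etaBetaNormal_equiv_finiteLiveStrategies (T : Ty Unit) :
    Nonempty (NF Unit [] T ≃
      { σ : Set (List (ℕ × ℕ)) //
          IsStrategy (PG (gameOf (tyTrans T) none)) σ ∧
          Live (PG (gameOf (tyTrans T) none)) σ ∧
          σ.Finite }) := by
  refine ⟨Equiv.ofBijective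
    (fun t => ⟨t.strategy, stratAt_nil_iff.1 t.stratAt_strategy⟩) ⟨fun t t' h => ?_, ?_⟩⟩
  · refine t.plays_injective t' 1 [] rfl List.nodup_nil (by simp) ?_
    ext q
    have hq := Set.ext_iff.1 (congrArg Subtype.val h) ((0, 1) :: q)
    exact (and_iff_right rfl).symm.trans (hq.trans (and_iff_right rfl))
  · rintro ⟨σ, hσ⟩
    have h := stratAt_nil_iff.2 hσ
    have h01 : [(0, 1)] ∈ σ :=
      h.live [] h.nil_mem (by simp) _ ((singleton_mem_PG T _).2 rfl)
    obtain ⟨N, hN⟩ := (h.finite.image List.length).bddAbove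
    obtain ⟨t, ht⟩ := NF.exists_plays_eq (N + 1) (pAt_start T) (h.after h01) fun q hq => by
      have := hN ⟨_, hq, rfl⟩
      simp only [List.length_cons] at this
      omega
    refine ⟨t, Subtype.ext ?_⟩
    ext (_ | ⟨m, q⟩)
    · exact iff_of_true trivial h.nil_mem
    · have hq : q ∈ t.plays 1 [] ↔ (0, 1) :: q ∈ σ := Set.ext_iff.1 ht q
      constructor
      · rintro ⟨rfl, hm⟩
        exact hq.1 hm
      · intro hm
        obtain rfl := (singleton_mem_PG T m).1 (h.append_mem _ (h.singleton_mem hm))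
        exact ⟨rfl, hq.2 hm⟩

end Hypergames
end

section
/- Let T be a simple type generated from a set Var of type variables by implication →. The η-expanded β-normal closed λ-terms of type T are in bijection with the finite live strategies on the P-backtracking game 𝒫G(Δ_T) which satisfy the copycat condition. -/
namespace Hypergames

/-- The state of `Δ_T` at position `j` (1-indexed, `0` being the start) of a dialogue whose
positions have types `L`. -/
def stateAt {V : Type} (L : List (Ty V)) (j : ℕ) : Option (Ty V) :=
  if j = 0 then none else L[j-1]?

/-- The dialogue `d` belongs to `𝒫G(Δ_T)`, and `L` lists the types reached by its moves. -/
def Run {V : Type} (T : Ty V) (d : List (ℕ × ℕ)) (L : List (Ty V)) : Prop :=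
  L.length = d.length ∧ ∀ j α i, d[j]? = some (α, i) →
    α ≤ j ∧ Odd (j + 1 - α) ∧ (Odd (j + 1) → α = j) ∧
      tyTrans T (stateAt L α) i = some (L[j]?)

theorem stateAt_append {V : Type} {L : List (Ty V)} {j : ℕ} (h : j ≤ L.length)
    (L' : List (Ty V)) : stateAt (L ++ L') j = stateAt L j := by
  unfold stateAt
  split_ifs with h0
  · rfl
  · rw [List.getElem?_append_left (by omega)]

theorem run_concat {V : Type} (T : Ty V) (d : List (ℕ × ℕ)) (α i : ℕ) (L : List (Ty V))
    (U : Ty V) :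
    Run T (d ++ [(α, i)]) (L ++ [U]) ↔
      Run T d L ∧ α ≤ L.length ∧ Odd (L.length + 1 - α) ∧
        (Odd (L.length + 1) → α = L.length) ∧ tyTrans T (stateAt L α) i = some (some U) := by
  constructor
  · rintro ⟨hl, h⟩
    have hl : L.length = d.length := by simpa using hl
    refine ⟨⟨hl, fun j β k hj => ?_⟩, ?_⟩
    · have hjl : j < d.length := by
        by_contra hc
        rw [List.getElem?_eq_none (by omega)] at hj
        cases hj
      obtain ⟨h1, h2, h3, h4⟩ := h j β k (by rw [List.getElem?_append_left hjl, hj])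
      refine ⟨h1, h2, h3, ?_⟩
      rwa [stateAt_append (by omega), List.getElem?_append_left (by omega)] at h4
    · obtain ⟨h1, h2, h3, h4⟩ := h L.length α i (by simp [hl])
      refine ⟨h1, h2, h3, ?_⟩
      rw [stateAt_append h1] at h4
      simpa using h4
  · rintro ⟨⟨hl, h⟩, h1, h2, h3, h4⟩
    refine ⟨by simp [hl], fun j β k hj => ?_⟩
    rcases lt_trichotomy j d.length with hlt | rfl | hgt
    · rw [List.getElem?_append_left hlt] at hj
      obtain ⟨g1, g2, g3, g4⟩ := h j β k hj
      refine ⟨g1, g2, g3, ?_⟩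
      rwa [stateAt_append (by omega), List.getElem?_append_left (by omega)]
    · simp only [List.getElem?_concat_length, Option.some.injEq, Prod.mk.injEq] at hj
      obtain ⟨rfl, rfl⟩ := hj
      rw [← hl]
      refine ⟨h1, h2, h3, ?_⟩
      rw [stateAt_append h1, h4]
      simp
    · rw [List.getElem?_eq_none (by simp; omega)] at hj
      cases hj

theorem run_concat_iff {V : Type} {T : Ty V} {d : List (ℕ × ℕ)} {m : ℕ × ℕ}
    {L' : List (Ty V)} :
    Run T (d ++ [m]) L' ↔ ∃ L U, L' = L ++ [U] ∧ Run T d L ∧ m.1 ≤ L.length ∧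
      Odd (L.length + 1 - m.1) ∧ (Odd (L.length + 1) → m.1 = L.length) ∧
        tyTrans T (stateAt L m.1) m.2 = some (some U) := by
  obtain ⟨α, i⟩ := m
  constructor
  · intro h
    rcases List.eq_nil_or_concat L' with rfl | ⟨L, U, rfl⟩
    · simpa using h.1
    · rw [List.concat_eq_append] at h ⊢
      exact ⟨L, U, rfl, (run_concat T d α i L U).1 h⟩
  · rintro ⟨L, U, rfl, h⟩
    exact (run_concat T d α i L U).2 h

theorem run_nil {V : Type} (T : Ty V) : Run T [] [] := by
  simp [Run]

theorem Run.unique {V : Type} {T : Ty V} {d : List (ℕ × ℕ)} :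
    ∀ {L L' : List (Ty V)}, Run T d L → Run T d L' → L = L' := by
  induction d using List.reverseRecOn with
  | nil =>
    intro L L' h h'
    rw [List.length_eq_zero_iff.1 h.1, List.length_eq_zero_iff.1 h'.1]
  | append_singleton d m ih =>
    intro L L' h h'
    obtain ⟨L, U, rfl, h, -, -, -, hU⟩ := run_concat_iff.1 h
    obtain ⟨L', U', rfl, h', -, -, -, hU'⟩ := run_concat_iff.1 h'
    obtain rfl := ih h h'
    rw [hU] at hU'
    simp only [Option.some.injEq] at hU'
    rw [hU']

theorem reach_append {Q K : Type} (tr : Q → K → Option Q) (q : Q) (ls ls' : List K) :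
    reach tr q (ls ++ ls') = (reach tr q ls).bind fun q' => reach tr q' ls' := by
  induction ls generalizing q with
  | nil => rfl
  | cons l ls ih =>
    simp only [List.cons_append, reach]
    cases tr q l with
    | none => rfl
    | some q' => exact ih q'

theorem reach_singleton {Q K : Type} (tr : Q → K → Option Q) (q : Q) (l : K) :
    reach tr q [l] = tr q l := by
  simp [reach]

theorem tyTrans_eq_some {V : Type} {T : Ty V} {s : Option (Ty V)} {i : ℕ}
    (h : (tyTrans T s i).isSome) : ∃ U, tyTrans T s i = some (some U) := by
  cases s with
  | none =>
    by_cases hi : i = 1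
    · exact ⟨T, by simp [tyTrans, hi]⟩
    · simp [tyTrans, hi] at h
  | some S =>
    by_cases hi : 1 ≤ i
    · rw [tyTrans, if_pos hi, Option.isSome_map] at h
      obtain ⟨U, hU⟩ := Option.isSome_iff_exists.1 h
      exact ⟨U, by simp [tyTrans, hi, hU]⟩
    · simp [tyTrans, hi] at h

theorem isChain_concat {M : Type} (d : List (ℕ × M)) (ds : List ℕ) (b : ℕ) :
    IsChain d (ds ++ [b]) ↔ IsChain d ds ∧ 1 ≤ b ∧ b ≤ d.length ∧
      pointer d b = some (ds.getLastD 0) ∧ ds.getLastD 0 < b := by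
  unfold IsChain List.Chain'
  rcases List.eq_nil_or_concat ds with rfl | ⟨ds, a, rfl⟩
  · simp only [List.nil_append, List.mem_singleton, forall_eq, List.head?_cons, Option.some.injEq,
      forall_eq', List.isChain_singleton, List.not_mem_nil, List.head?_nil, List.isChain_nil,
      List.getLastD_nil]
    simp
    tauto
  · have hh : (ds ++ [a] ++ [b]).head? = (ds ++ [a]).head? := by cases ds <;> simp
    have hl : (ds ++ [a]).getLastD 0 = a := by simp
    have hl' : (ds ++ [a]).getLast? = some a := by simp
    rw [List.concat_eq_append, List.isChain_append, List.isChain_append (l₁ := ds ++ [a]), hh, hl,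
      hl']
    simp only [List.mem_append (s := ds ++ [a]), or_imp, forall_and, List.mem_singleton, forall_eq,
      Option.mem_some, forall_eq', List.head?_cons, List.isChain_singleton]
    tauto

theorem threadOf_concat {M : Type} {d : List (ℕ × M)} {b : ℕ} {α : ℕ} {m : M} (ds : List ℕ)
    (h : d[b-1]? = some (α, m)) : threadOf d (ds ++ [b]) = threadOf d ds ++ [m] := by
  simp [threadOf, h]

theorem pointer_eq_some {M : Type} {d : List (ℕ × M)} {j α : ℕ} :
    pointer d j = some α ↔ ∃ m, d[j-1]? = some (α, m) := by
  simp [pointer, Option.map_eq_some_iff]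

theorem Run.transition {V : Type} {T : Ty V} {d : List (ℕ × ℕ)} {L : List (Ty V)}
    (h : Run T d L) {j α i : ℕ} (hj : 1 ≤ j) (hd : d[j-1]? = some (α, i)) :
    tyTrans T (stateAt L α) i = some (stateAt L j) := by
  rw [(h.2 (j-1) α i hd).2.2.2, stateAt, if_neg (by omega)]

theorem Run.reach_threadOf {V : Type} {T : Ty V} {d : List (ℕ × ℕ)} {L : List (Ty V)}
    (h : Run T d L) (ds : List ℕ) (hds : IsChain d ds) :
    reach (tyTrans T) none (threadOf d ds) = some (stateAt L (ds.getLastD 0)) := by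
  induction ds using List.reverseRecOn with
  | nil => simp [threadOf, reach, stateAt]
  | append_singleton ds b ih =>
    obtain ⟨hds, hb, -, hp, -⟩ := (isChain_concat d ds b).1 hds
    obtain ⟨i, hi⟩ := pointer_eq_some.1 hp
    rw [threadOf_concat ds hi, reach_append, ih hds]
    simp only [Option.bind_some, reach_singleton]
    rw [h.transition hb hi]
    simp

theorem Run.reach_threadTo {V : Type} {T : Ty V} {d : List (ℕ × ℕ)} {L : List (Ty V)}
    (h : Run T d L) (f j : ℕ) (hj : 1 ≤ j) (hjd : j ≤ d.length) (hf : j ≤ f) :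
    reach (tyTrans T) none (threadTo d f j) = some (stateAt L j) := by
  induction f generalizing j with
  | zero => omega
  | succ f ih =>
    obtain ⟨⟨α, i⟩, hd⟩ : ∃ m, d[j-1]? = some m := ⟨_, List.getElem?_eq_getElem (by omega)⟩
    have ht := h.transition hj hd
    have hα := (h.2 _ _ _ hd).1
    simp only [threadTo, hd]
    split_ifs with h0
    · subst h0
      rw [reach_singleton]
      exact ht
    · rw [reach_append, ih α (by omega) (by omega) (by omega)]
      simpa only [Option.bind_some, reach_singleton] using ht

theorem Run.colourAt {V : Type} {T : Ty V} {d : List (ℕ × ℕ)} {L : List (Ty V)}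
    (h : Run T d L) {j : ℕ} (hj : 1 ≤ j) (hjd : j ≤ d.length) :
    colourAt T d j = (L[j-1]?).map Ty.headVar := by
  have hl := h.1
  rw [Hypergames.colourAt, h.reach_threadTo j j hj hjd le_rfl, stateAt, if_neg (by omega),
    List.getElem?_eq_getElem (by omega)]
  rfl

theorem exists_isChain {M : Type} {d : List (ℕ × M)} (hd : IsDialogue d) (j : ℕ)
    (hj : j ≤ d.length) : ∃ ds, IsChain d ds ∧ ds.getLastD 0 = j := by
  induction j using Nat.strong_induction_on with
  | _ j ih =>
    rcases Nat.eq_zero_or_pos j with rfl | h0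
    · exact ⟨[], by simp [IsChain, List.Chain'], rfl⟩
    · obtain ⟨⟨α, i⟩, hm⟩ : ∃ m, d[j-1]? = some m := ⟨_, List.getElem?_eq_getElem (by omega)⟩
      have hp : pointer d j = some α := pointer_eq_some.2 ⟨i, hm⟩
      obtain ⟨hα, -⟩ := hd j h0 hj α hp
      obtain ⟨ds, hds, hl⟩ := ih α hα (by omega)
      exact ⟨ds ++ [j], (isChain_concat d ds j).2 ⟨hds, h0, hj, by rw [hl, hp], by omega⟩, by simp⟩

theorem pointer_append {M : Type} {d : List (ℕ × M)} {j : ℕ} (hj : 1 ≤ j) (hjd : j ≤ d.length)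
    (d' : List (ℕ × M)) : pointer (d ++ d') j = pointer d j := by
  rw [pointer, pointer, List.getElem?_append_left (by omega)]

theorem IsChain.append {M : Type} {d : List (ℕ × M)} {ds : List ℕ} (h : IsChain d ds)
    (d' : List (ℕ × M)) :
    IsChain (d ++ d') ds ∧ threadOf (d ++ d') ds = threadOf d ds := by
  induction ds using List.reverseRecOn with
  | nil => simp [IsChain, List.Chain', threadOf]
  | append_singleton ds b ih =>
    obtain ⟨hds, hb, hbd, hp, hlt⟩ := (isChain_concat d ds b).1 h
    obtain ⟨h1, h2⟩ := ih hds
    obtain ⟨i, hi⟩ := pointer_eq_some.1 hp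
    refine ⟨(isChain_concat _ _ _).2 ⟨h1, hb, by simp; omega, ?_, hlt⟩, ?_⟩
    · rw [pointer_append hb hbd, hp]
    · rw [threadOf_concat ds hi, threadOf_concat ds (α := ds.getLastD 0) (m := i), h2]
      rw [List.getElem?_append_left (by omega), hi]

theorem mem_PG_of_append {M : Type} {G : Set (List M)} {d d' : List (ℕ × M)}
    (h : d ++ d' ∈ PG G) : d ∈ PG G := by
  obtain ⟨⟨h1, h2⟩, h3⟩ := h
  refine ⟨⟨fun j hj hjd α hα => h1 j hj (by simp; omega) α (by rw [pointer_append hj hjd, hα]),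
    fun ds hds => ?_⟩, fun j hj hjd => ?_⟩
  · rw [← (hds.append d').2]
    exact h2 ds (hds.append d').1
  · rw [← pointer_append hj.pos hjd d']
    exact h3 j hj (by simp; omega)

theorem mem_PG_iff {V : Type} {T : Ty V} {d : List (ℕ × ℕ)} :
    d ∈ PG (gameOf (tyTrans T) none) ↔ ∃ L, Run T d L := by
  constructor
  · induction d using List.reverseRecOn with
    | nil => exact fun _ => ⟨[], run_nil T⟩
    | append_singleton d m ih =>
      intro h
      obtain ⟨α, i⟩ := m
      have hd := mem_PG_of_append h
      obtain ⟨L, hL⟩ := ih hd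
      have hl := hL.1
      have hm : (d ++ [(α, i)])[d.length + 1 - 1]? = some (α, i) := by simp
      have hp : pointer (d ++ [(α, i)]) (d.length + 1) = some α := pointer_eq_some.2 ⟨i, hm⟩
      obtain ⟨⟨h1, h2⟩, h3⟩ := h
      obtain ⟨hlt, hodd⟩ := h1 (d.length + 1) (by omega) (by simp) α hp
      obtain ⟨ds, hds, hlast⟩ := exists_isChain hd.1.1 α (by omega)
      have hc := h2 (ds ++ [d.length + 1]) ((isChain_concat _ _ _).2
        ⟨(hds.append _).1, by omega, by simp, by rw [hp, hlast], by omega⟩)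
      rw [threadOf_concat ds hm, (hds.append _).2] at hc
      simp only [gameOf, Set.mem_ofPred_eq, reach_append, hL.reach_threadOf ds hds, hlast,
        Option.bind_some, reach_singleton] at hc
      obtain ⟨U, hU⟩ := tyTrans_eq_some hc
      refine ⟨L ++ [U], (run_concat T d α i L U).2 ⟨hL, by omega, by rwa [hl], fun ho => ?_, hU⟩⟩
      have := h3 (d.length + 1) (by rwa [← hl]) (by simp)
      rw [hp] at this
      simp only [Option.some.injEq] at this
      omega
  · rintro ⟨L, h⟩
    refine ⟨⟨fun j hj hjd α hα => ?_, fun ds hds => ?_⟩, fun j hj hjd => ?_⟩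
    · obtain ⟨i, hi⟩ := pointer_eq_some.1 hα
      obtain ⟨h1, h2, -⟩ := h.2 _ _ _ hi
      rw [Nat.sub_add_cancel hj] at h2
      exact ⟨by omega, h2⟩
    · rw [gameOf, Set.mem_ofPred_eq, h.reach_threadOf ds hds]
      rfl
    · have h0 := hj.pos
      obtain ⟨⟨α, i⟩, hm⟩ : ∃ m, d[j-1]? = some m := ⟨_, List.getElem?_eq_getElem (by omega)⟩
      have := (h.2 _ _ _ hm).2.2.1 (by rwa [Nat.sub_add_cancel h0])
      exact pointer_eq_some.2 ⟨i, by rw [hm, this]⟩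

/-- Branch `i` of the type at the odd position `α` is a variable of type `U`. -/
def VarOf {V : Type} (L : List (Ty V)) (α i : ℕ) (U : Ty V) : Prop :=
  Odd α ∧ 1 ≤ i ∧ ∃ A, L[α-1]? = some A ∧ A.branches[i-1]? = some U

theorem VarOf.le {V : Type} {L : List (Ty V)} {α i : ℕ} {U : Ty V} (h : VarOf L α i U) :
    α ≤ L.length := by
  obtain ⟨-, -, A, hA, -⟩ := h
  obtain ⟨hlt, -⟩ := List.getElem?_eq_some_iff.1 hA
  omega

theorem tyTrans_some_iff {V : Type} {T A U : Ty V} {i : ℕ} :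
    tyTrans T (some A) i = some (some U) ↔ 1 ≤ i ∧ A.branches[i-1]? = some U := by
  by_cases hi : 1 ≤ i <;> simp [tyTrans, hi]

theorem run_concat_of_odd {V : Type} {T : Ty V} {d : List (ℕ × ℕ)} {α i : ℕ} {L : List (Ty V)}
    {U : Ty V} (hL : Odd L.length) :
    Run T (d ++ [(α, i)]) (L ++ [U]) ↔ Run T d L ∧ VarOf L α i U := by
  rw [run_concat]
  refine and_congr_right fun _ => ⟨?_, fun h => ?_⟩
  · rintro ⟨h1, h2, -, h4⟩
    have hα : Odd α := by grind
    have h0 := hα.pos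
    rw [stateAt, if_neg (by omega), List.getElem?_eq_getElem (by omega), tyTrans_some_iff] at h4
    exact ⟨hα, h4.1, _, List.getElem?_eq_getElem _, h4.2⟩
  · have hle := h.le
    obtain ⟨hα, hi, A, hA, hU⟩ := h
    have h0 := hα.pos
    refine ⟨hle, by grind, by grind, ?_⟩
    rw [stateAt, if_neg (by omega), hA, tyTrans_some_iff]
    exact ⟨hi, hU⟩

theorem run_concat_of_even {V : Type} {T : Ty V} {d : List (ℕ × ℕ)} {α i : ℕ} {L : List (Ty V)}
    {U S : Ty V} (hL : Odd L.length) :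
    Run T (d ++ [(α, i)]) (L ++ [U] ++ [S]) ↔
      Run T d (L ++ [U]) ∧ α = L.length + 1 ∧ 1 ≤ i ∧ U.branches[i-1]? = some S := by
  have hs : stateAt (L ++ [U]) (L.length + 1) = some U := by simp [stateAt]
  rw [run_concat]
  refine and_congr_right fun _ => ⟨?_, ?_⟩
  · rintro ⟨h1, h2, h3, h4⟩
    rw [List.length_append, List.length_singleton] at h3
    obtain rfl := h3 (by grind)
    rw [hs, tyTrans_some_iff] at h4
    exact ⟨rfl, h4⟩
  · rintro ⟨rfl, h⟩
    refine ⟨by simp, by simp, by simp, ?_⟩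
    rw [hs, tyTrans_some_iff]
    exact h

/-- The moves naming the variables bound by the abstractions of a term of type `S` whose
starting move is at position `n`. -/
def binders {V : Type} (n : ℕ) (S : Ty V) : List (ℕ × ℕ) :=
  (List.range S.branches.length).map fun i => (n, i + 1)

/-- `W` lists without repetition the moves naming the variables available after a dialogue with
types `L`, and `Γ` lists the types of these variables. -/
structure Names {V : Type} (L : List (Ty V)) (W : List (ℕ × ℕ)) (Γ : List (Ty V)) : Prop where
  length_eq : W.length = Γ.length
  nodup : W.Nodup
  varOf_iff : ∀ α i U, VarOf L α i U ↔ ∃ k : ℕ, W[k]? = some (α, i) ∧ Γ[k]? = some U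

theorem Names.concat_even {V : Type} {L : List (Ty V)} {W : List (ℕ × ℕ)} {Γ : List (Ty V)}
    (h : Names L W Γ) (hL : Odd L.length) (U : Ty V) : Names (L ++ [U]) W Γ := by
  refine ⟨h.length_eq, h.nodup, fun α i U' => ?_⟩
  rw [← h.varOf_iff]
  refine and_congr_right fun hα => and_congr_right fun _ => ?_
  have h0 := hα.pos
  rcases lt_trichotomy (α - 1) L.length with hlt | heq | hgt
  · rw [List.getElem?_append_left hlt]
  · exfalso; grind
  · rw [List.getElem?_eq_none (by simp; omega), List.getElem?_eq_none (by omega)]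

theorem Names.concat_odd {V : Type} {L : List (Ty V)} {W : List (ℕ × ℕ)} {Γ : List (Ty V)}
    (h : Names L W Γ) (hL : Even L.length) (S : Ty V) :
    Names (L ++ [S]) (W ++ binders (L.length + 1) S) (Γ ++ S.branches) := by
  have hb : (binders (L.length + 1) S).length = S.branches.length := by simp [binders]
  refine ⟨by simp [h.length_eq, hb], ?_, fun α i U => ⟨fun hv => ?_, ?_⟩⟩
  · refine List.Nodup.append h.nodup (List.nodup_range.map fun a b hab => by simpa using hab) ?_
    rintro ⟨α, i⟩ hm hm'
    obtain ⟨k, hk, hkm⟩ := List.getElem_of_mem hm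
    have hk' : k < Γ.length := h.length_eq ▸ hk
    have hv := ((h.varOf_iff α i Γ[k]).2 ⟨k, by rw [List.getElem?_eq_getElem hk, hkm],
      List.getElem?_eq_getElem hk'⟩).le
    simp only [binders, List.mem_map, Prod.mk.injEq] at hm'
    obtain ⟨_, -, h1, -⟩ := hm'
    omega
  · have hle := hv.le
    obtain ⟨hα, hi, A, hA, hU⟩ := hv
    have h0 := hα.pos
    simp only [List.length_append, List.length_singleton] at hle
    rcases Nat.lt_or_ge (α - 1) L.length with hlt | hge
    · rw [List.getElem?_append_left hlt] at hA
      obtain ⟨k, hk, hk'⟩ := (h.varOf_iff α i U).1 ⟨hα, hi, A, hA, hU⟩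
      refine ⟨k, ?_, ?_⟩
      · rw [List.getElem?_append_left (List.getElem?_eq_some_iff.1 hk).1, hk]
      · rw [List.getElem?_append_left (List.getElem?_eq_some_iff.1 hk').1, hk']
    · obtain rfl : α = L.length + 1 := by omega
      simp only [Nat.add_sub_cancel, List.getElem?_concat_length, Option.some.injEq] at hA
      subst hA
      have hlt := (List.getElem?_eq_some_iff.1 hU).1
      refine ⟨W.length + (i - 1), ?_, ?_⟩
      · rw [List.getElem?_append_right (by omega)]
        simp [binders, hlt]
        omega
      · rw [h.length_eq, List.getElem?_append_right (by omega)]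
        simpa using hU
  · rintro ⟨k, hk, hk'⟩
    rcases Nat.lt_or_ge k W.length with hlt | hge
    · rw [List.getElem?_append_left hlt] at hk
      rw [List.getElem?_append_left (h.length_eq ▸ hlt)] at hk'
      have hv := (h.varOf_iff α i U).2 ⟨k, hk, hk'⟩
      have hle := hv.le
      obtain ⟨hα, hi, A, hA, hU⟩ := hv
      refine ⟨hα, hi, A, ?_, hU⟩
      have := (List.getElem?_eq_some_iff.1 hA).1
      rw [List.getElem?_append_left this, hA]
    · rw [List.getElem?_append_right hge] at hk
      rw [List.getElem?_append_right (h.length_eq ▸ hge), ← h.length_eq] at hk'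
      obtain ⟨a, ha, hm⟩ := List.mem_map.1 (List.mem_of_getElem? hk)
      have hka : k - W.length = a := by
        simp only [binders, List.getElem?_map, Option.map_eq_some_iff] at hk
        obtain ⟨b, hb, hbm⟩ := hk
        obtain ⟨hlt, hb⟩ := List.getElem?_eq_some_iff.1 hb
        simp at hb hbm hm
        omega
      simp only [Prod.mk.injEq] at hm
      obtain ⟨rfl, rfl⟩ := hm
      refine ⟨by grind, by omega, S, by simp, ?_⟩
      rw [← hk', hka, Nat.add_sub_cancel]

/-- After the odd-length dialogue `p` the opponent has just asked for a term of type `S`, the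
moves in `W` naming the variables of the context `Γ`. -/
def Asks {V : Type} (T : Ty V) (W p : List (ℕ × ℕ)) (Γ : List (Ty V)) (S : Ty V) : Prop :=
  ∃ L, Run T p (L ++ [S]) ∧ Even L.length ∧ Names L W Γ

/-- The moves naming the variables of the extended context `Γ, x₁, …, xₙ`. -/
def scope {V : Type} (W p : List (ℕ × ℕ)) (S : Ty V) : List (ℕ × ℕ) :=
  W ++ binders p.length S

/-- The answer to `p` with the head variable of index `k`. -/
def answer {V : Type} (W p : List (ℕ × ℕ)) (S : Ty V) (k : ℕ) : List (ℕ × ℕ) :=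
  p ++ [(scope W p S).getD k (0, 0)]

/-- The answer to `p` with the head variable of index `k`, followed by the opponent asking for
its argument of index `j`. -/
def ask {V : Type} (W p : List (ℕ × ℕ)) (S : Ty V) (k j : ℕ) : List (ℕ × ℕ) :=
  answer W p S k ++ [(p.length + 1, j + 1)]

theorem length_answer {V : Type} (W p : List (ℕ × ℕ)) (S : Ty V) (k : ℕ) :
    (answer W p S k).length = p.length + 1 := by simp [answer]

theorem length_ask {V : Type} (W p : List (ℕ × ℕ)) (S : Ty V) (k j : ℕ) :
    (ask W p S k j).length = p.length + 2 := by simp [ask, answer]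

section Asks

variable {V : Type} {T : Ty V} {W p : List (ℕ × ℕ)} {Γ : List (Ty V)} {S : Ty V}

theorem Asks.odd (h : Asks T W p Γ S) : Odd p.length := by
  obtain ⟨L, hr, hL, -⟩ := h
  rw [← hr.1]
  simpa using hL.add_one

theorem Asks.mem_PG (h : Asks T W p Γ S) : p ∈ PG (gameOf (tyTrans T) none) := by
  obtain ⟨L, hr, -⟩ := h
  exact mem_PG_iff.2 ⟨_, hr⟩

theorem Asks.names (h : Asks T W p Γ S) : ∃ L, Run T p (L ++ [S]) ∧ Odd (L ++ [S]).length ∧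
    Names (L ++ [S]) (scope W p S) (Γ ++ S.branches) := by
  obtain ⟨L, hr, hL, hn⟩ := h
  have hl := hr.1
  simp only [List.length_append, List.length_singleton] at hl
  refine ⟨L, hr, by simpa using hL.add_one, ?_⟩
  rw [scope, ← hl]
  exact hn.concat_odd hL S

theorem Names.varOf_get {L : List (Ty V)} (h : Names L W Γ) (k : Fin Γ.length) :
    VarOf L (W.getD k (0, 0)).1 (W.getD k (0, 0)).2 (Γ.get k) := by
  have hk : (k : ℕ) < W.length := k.2.trans_eq h.length_eq.symm
  refine (h.varOf_iff _ _ _).2 ⟨k, ?_, by simp⟩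
  simp [List.getD_eq_getElem?_getD, hk]

theorem Asks.run_answer (h : Asks T W p Γ S) (k : Fin (Γ ++ S.branches).length) :
    ∃ L, Run T (answer W p S k) (L ++ [S] ++ [(Γ ++ S.branches).get k]) ∧
      Run T p (L ++ [S]) ∧ Odd (L ++ [S]).length ∧
      Names (L ++ [S]) (scope W p S) (Γ ++ S.branches) := by
  obtain ⟨L, hr, hL, hn⟩ := h.names
  exact ⟨L, (run_concat_of_odd hL).2 ⟨hr, hn.varOf_get k⟩, hr, hL, hn⟩

theorem Asks.answer_mem_PG (h : Asks T W p Γ S) (k : Fin (Γ ++ S.branches).length) :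
    answer W p S k ∈ PG (gameOf (tyTrans T) none) := by
  obtain ⟨L, hr, -⟩ := h.run_answer k
  exact mem_PG_iff.2 ⟨_, hr⟩

theorem Asks.ask (h : Asks T W p Γ S) (k : Fin (Γ ++ S.branches).length)
    (j : Fin ((Γ ++ S.branches).get k).branches.length) :
    Asks T (scope W p S) (ask W p S k j) (Γ ++ S.branches)
      (((Γ ++ S.branches).get k).branches.get j) := by
  obtain ⟨L, hr, hp, hL, hn⟩ := h.run_answer k
  refine ⟨_, (run_concat_of_even hL).2 ⟨hr, ?_, by omega, by simp⟩, ?_, hn.concat_even hL _⟩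
  · rw [hp.1]
  · rw [List.length_append, List.length_singleton]
    exact hL.add_one

theorem Asks.eq_ask (h : Asks T W p Γ S) (k : Fin (Γ ++ S.branches).length) {m : ℕ × ℕ}
    (hm : answer W p S k ++ [m] ∈ PG (gameOf (tyTrans T) none)) :
    ∃ j : Fin ((Γ ++ S.branches).get k).branches.length,
      answer W p S k ++ [m] = Hypergames.ask W p S k j := by
  obtain ⟨L, hr, hp, hL, -⟩ := h.run_answer k
  obtain ⟨L', hL'⟩ := mem_PG_iff.1 hm
  obtain ⟨L', S', rfl, hr', -⟩ := run_concat_iff.1 hL'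
  obtain rfl := hr.unique hr'
  obtain ⟨α, i⟩ := m
  obtain ⟨-, rfl, hi, hS⟩ := (run_concat_of_even hL).1 hL'
  refine ⟨⟨i - 1, (List.getElem?_eq_some_iff.1 hS).1⟩, ?_⟩
  rw [Hypergames.ask, hp.1, Nat.sub_add_cancel hi]

theorem Asks.eq_answer (h : Asks T W p Γ S) {m : ℕ × ℕ}
    (hm : p ++ [m] ∈ PG (gameOf (tyTrans T) none)) :
    ∃ k : Fin (Γ ++ S.branches).length, p ++ [m] = answer W p S k := by
  obtain ⟨L, hr, hL, hn⟩ := h.names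
  obtain ⟨L', hL'⟩ := mem_PG_iff.1 hm
  obtain ⟨L', U, rfl, hr', -⟩ := run_concat_iff.1 hL'
  obtain rfl := hr.unique hr'
  obtain ⟨α, i⟩ := m
  obtain ⟨-, hv⟩ := (run_concat_of_odd hL).1 hL'
  obtain ⟨k, hk, hk'⟩ := (hn.varOf_iff _ _ _).1 hv
  refine ⟨⟨k, (List.getElem?_eq_some_iff.1 hk').1⟩, ?_⟩
  simp [answer, List.getD_eq_getElem?_getD, hk]

theorem Asks.answer_injective (h : Asks T W p Γ S) {k k' : Fin (Γ ++ S.branches).length}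
    (hk : answer W p S k = answer W p S k') : k = k' := by
  obtain ⟨L, -, -, hn⟩ := h.names
  have h1 : (k : ℕ) < (scope W p S).length := k.2.trans_eq hn.length_eq.symm
  have h2 : (k' : ℕ) < (scope W p S).length := k'.2.trans_eq hn.length_eq.symm
  simp only [answer, List.getD_eq_getElem?_getD, List.getElem?_eq_getElem h1,
    List.getElem?_eq_getElem h2, Option.getD_some, List.append_cancel_left_eq, List.cons.injEq,
    and_true] at hk
  exact Fin.ext (hn.nodup.getElem_inj_iff.1 hk)

end Asks

theorem ask_injective {V : Type} {W p : List (ℕ × ℕ)} {S : Ty V} {k j j' : ℕ}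
    (h : ask W p S k j = ask W p S k j') : j = j' := by
  simpa [ask] using h

theorem Run.copycatDialogue_iff {V : Type} {T : Ty V} {d : List (ℕ × ℕ)} {L : List (Ty V)}
    (h : Run T d L) : CopycatDialogue T d ↔ ∀ j, Even j → 2 ≤ j → j ≤ L.length →
      (L[j-1]?).map Ty.headVar = (L[j-2]?).map Ty.headVar := by
  rw [h.1]
  refine forall_congr' fun j => forall_congr' fun _ => forall_congr' fun h2 => forall_congr'
    fun hj => ?_
  rw [h.colourAt (by omega) hj, h.colourAt (by omega) (by omega), Nat.sub_sub]

theorem copycatDialogue_concat {V : Type} {T : Ty V} {d : List (ℕ × ℕ)} {L : List (Ty V)}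
    {m : ℕ × ℕ} {A U : Ty V} (h : Run T d (L ++ [A])) (h' : Run T (d ++ [m]) (L ++ [A] ++ [U])) :
    CopycatDialogue T (d ++ [m]) ↔
      CopycatDialogue T d ∧ (Even L.length → U.headVar = A.headVar) := by
  rw [h.copycatDialogue_iff, h'.copycatDialogue_iff]
  constructor
  · refine fun hc => ⟨fun j hj h2 hjl => ?_, fun he => ?_⟩
    · have := hc j hj h2 (by simp at hjl ⊢; omega)
      rwa [List.getElem?_append_left (l₁ := L ++ [A]) (by omega),
        List.getElem?_append_left (l₁ := L ++ [A]) (by omega)] at this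
    · have := hc (L.length + 2) (by grind) (by omega) (by simp)
      simpa using this
  · rintro ⟨hc, he⟩ j hj h2 hjl
    rcases Nat.lt_or_ge (L ++ [A]).length j with hlt | hge
    · obtain rfl : j = L.length + 2 := by simp at hlt hjl; omega
      simpa using he (by grind)
    · rw [List.getElem?_append_left (l₁ := L ++ [A]) (by omega),
        List.getElem?_append_left (l₁ := L ++ [A]) (by omega)]
      exact hc j hj h2 hge

section Copycat

variable {V : Type} {T : Ty V} {W p : List (ℕ × ℕ)} {Γ : List (Ty V)} {S : Ty V}

theorem Asks.copycat_answer (h : Asks T W p Γ S) (k : Fin (Γ ++ S.branches).length) :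
    CopycatDialogue T (answer W p S k) ↔
      CopycatDialogue T p ∧ ((Γ ++ S.branches).get k).headVar = S.headVar := by
  obtain ⟨L, hr, hp, hL, -⟩ := h.run_answer k
  rw [answer, copycatDialogue_concat hp hr]
  refine and_congr_right fun _ => ⟨fun hc => hc ?_, fun hc _ => hc⟩
  simp only [List.length_append, List.length_singleton] at hL
  grind

theorem Asks.copycat_ask (h : Asks T W p Γ S) (k : Fin (Γ ++ S.branches).length)
    (j : Fin ((Γ ++ S.branches).get k).branches.length)
    (hc : CopycatDialogue T (answer W p S k)) :
    CopycatDialogue T (Hypergames.ask W p S k j) := by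
  obtain ⟨L, hr, hp, hL, -⟩ := h.run_answer k
  have hr' : Run T (Hypergames.ask W p S k j) (L ++ [S] ++ [(Γ ++ S.branches).get k] ++
      [((Γ ++ S.branches).get k).branches.get j]) :=
    (run_concat_of_even hL).2 ⟨hr, by rw [hp.1], by omega, by simp⟩
  refine (copycatDialogue_concat hr hr').2 ⟨hc, fun he => ?_⟩
  exact absurd hL (Nat.not_odd_iff_even.2 he)

end Copycat

/-- The traces extending `p` of the strategy denoted by a term, when the opponent has asked for
this term by `p` and the moves in `W` name the variables of its context. -/
def traces {V : Type} : {Γ : List (Ty V)} → {S : Ty V} → NF V Γ S → List (ℕ × ℕ) →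
    List (ℕ × ℕ) → Set (List (ℕ × ℕ))
  | _, _, .mk _ S k _ args, W, p =>
    {p, answer W p S k} ∪ ⋃ j, traces (args j) (scope W p S) (ask W p S k j)

theorem mem_traces_mk {V : Type} {Γ : List (Ty V)} {S : Ty V}
    {k : Fin (Γ ++ S.branches).length} {hk : ((Γ ++ S.branches).get k).headVar = S.headVar}
    {args : (j : Fin ((Γ ++ S.branches).get k).branches.length) →
      NF V (Γ ++ S.branches) (((Γ ++ S.branches).get k).branches.get j)}
    {W p r : List (ℕ × ℕ)} :
    r ∈ traces (NF.mk Γ S k hk args) W p ↔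
      r = p ∨ r = answer W p S k ∨ ∃ j, r ∈ traces (args j) (scope W p S) (ask W p S k j) := by
  simp [traces, or_assoc]

theorem self_mem_traces {V : Type} {Γ : List (Ty V)} {S : Ty V} (t : NF V Γ S)
    (W p : List (ℕ × ℕ)) : p ∈ traces t W p := by
  cases t
  exact mem_traces_mk.2 (Or.inl rfl)

theorem prefix_answer {V : Type} (W p : List (ℕ × ℕ)) (S : Ty V) (k : ℕ) :
    p <+: answer W p S k := List.prefix_append _ _

theorem answer_prefix_ask {V : Type} (W p : List (ℕ × ℕ)) (S : Ty V) (k j : ℕ) :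
    answer W p S k <+: ask W p S k j := List.prefix_append _ _

theorem prefix_of_mem_traces {V : Type} {Γ : List (Ty V)} {S : Ty V} (t : NF V Γ S)
    {W p r : List (ℕ × ℕ)} (h : r ∈ traces t W p) : p <+: r := by
  induction t generalizing W p with
  | mk Γ S k hk args ih =>
    rcases mem_traces_mk.1 h with rfl | rfl | ⟨j, hj⟩
    · exact List.prefix_rfl
    · exact prefix_answer ..
    · exact (prefix_answer ..).trans ((answer_prefix_ask ..).trans (ih j hj))

/-- A trace of a term extending the dialogue that asks for an argument is a trace of this
argument. -/
theorem mem_traces_arg {V : Type} {Γ : List (Ty V)} {S : Ty V}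
    {k : Fin (Γ ++ S.branches).length} {hk : ((Γ ++ S.branches).get k).headVar = S.headVar}
    {args : (j : Fin ((Γ ++ S.branches).get k).branches.length) →
      NF V (Γ ++ S.branches) (((Γ ++ S.branches).get k).branches.get j)}
    {W p r : List (ℕ × ℕ)} (hr : r ∈ traces (NF.mk Γ S k hk args) W p)
    {j : Fin ((Γ ++ S.branches).get k).branches.length} (hj : ask W p S k j <+: r) :
    r ∈ traces (args j) (scope W p S) (ask W p S k j) := by
  have hl := hj.length_le
  rw [length_ask] at hl
  rcases mem_traces_mk.1 hr with rfl | rfl | ⟨j', hj'⟩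
  · omega
  · rw [length_answer] at hl
    omega
  · have h1 := List.prefix_of_prefix_length_le hj (prefix_of_mem_traces _ hj')
      (by simp [length_ask])
    have h2 := ask_injective (h1.eq_of_length (by simp [length_ask]))
    obtain rfl : j = j' := Fin.ext h2
    exact hj'

section Strategy

variable {V : Type} {T : Ty V} {W p : List (ℕ × ℕ)} {Γ : List (Ty V)} {S : Ty V}

theorem traces_finite (t : NF V Γ S) (W p : List (ℕ × ℕ)) : (traces t W p).Finite := by
  induction t generalizing W p with
  | mk Γ S k hk args ih =>
    exact (Set.toFinite _).union (Set.finite_iUnion fun j => ih j _ _)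

theorem Asks.traces_subset (h : Asks T W p Γ S) (t : NF V Γ S) :
    traces t W p ⊆ PG (gameOf (tyTrans T) none) := by
  induction t generalizing W p with
  | mk Γ S k hk args ih =>
    intro r hr
    rcases mem_traces_mk.1 hr with rfl | rfl | ⟨j, hj⟩
    · exact h.mem_PG
    · exact h.answer_mem_PG k
    · exact ih j (h.ask k j) hj

theorem Asks.copycat_of_mem_traces (h : Asks T W p Γ S) (hp : CopycatDialogue T p)
    (t : NF V Γ S) {r : List (ℕ × ℕ)} (hr : r ∈ traces t W p) : CopycatDialogue T r := by
  induction t generalizing W p with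
  | mk Γ S k hk args ih =>
    have ha := (h.copycat_answer k).2 ⟨hp, hk⟩
    rcases mem_traces_mk.1 hr with rfl | rfl | ⟨j, hj⟩
    · exact hp
    · exact ha
    · exact ih j (h.ask k j) (h.copycat_ask k j ha) hj

theorem dropLast_mem_traces (t : NF V Γ S) {r : List (ℕ × ℕ)} (hr : r ∈ traces t W p)
    (hne : r ≠ p) : r.dropLast ∈ traces t W p := by
  induction t generalizing W p with
  | mk Γ S k hk args ih =>
    rcases mem_traces_mk.1 hr with rfl | rfl | ⟨j, hj⟩
    · exact absurd rfl hne
    · exact mem_traces_mk.2 (Or.inl (by simp [answer]))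
    · by_cases hrj : r = ask W p S k j
      · exact mem_traces_mk.2 (Or.inr (Or.inl (by simp [hrj, ask])))
      · exact mem_traces_mk.2 (Or.inr (Or.inr ⟨j, ih j hj hrj⟩))

theorem Asks.existsUnique_mem_traces (h : Asks T W p Γ S) (t : NF V Γ S) {r : List (ℕ × ℕ)}
    (hr : r ∈ traces t W p) (hodd : Odd r.length) : ∃! m, r ++ [m] ∈ traces t W p := by
  induction t generalizing W p with
  | mk Γ S k hk args ih =>
    rcases mem_traces_mk.1 hr with rfl | rfl | ⟨j, hj⟩
    · refine ⟨_, mem_traces_mk.2 (Or.inr (Or.inl rfl)), fun m hm => ?_⟩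
      rcases mem_traces_mk.1 hm with hm | hm | ⟨j, hj⟩
      · simp at hm
      · simpa [answer] using hm
      · have := (prefix_of_mem_traces _ hj).length_le
        simp [length_ask] at this
    · rw [length_answer] at hodd
      exact absurd h.odd (by grind)
    · obtain ⟨m, hm, hu⟩ := ih j (h.ask k j) hj
      refine ⟨m, mem_traces_mk.2 (Or.inr (Or.inr ⟨j, hm⟩)), fun m' hm' => hu m' ?_⟩
      exact mem_traces_arg hm' ((prefix_of_mem_traces _ hj).trans (List.prefix_append _ _))

theorem Asks.live_traces (h : Asks T W p Γ S) (t : NF V Γ S) {r : List (ℕ × ℕ)}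
    (hr : r ∈ traces t W p) (heven : Even r.length) {m : ℕ × ℕ}
    (hm : r ++ [m] ∈ PG (gameOf (tyTrans T) none)) : r ++ [m] ∈ traces t W p := by
  induction t generalizing W p with
  | mk Γ S k hk args ih =>
    rcases mem_traces_mk.1 hr with rfl | rfl | ⟨j, hj⟩
    · exact absurd h.odd (Nat.not_odd_iff_even.2 heven)
    · obtain ⟨j, hj⟩ := h.eq_ask k hm
      exact mem_traces_mk.2 (Or.inr (Or.inr ⟨j, hj ▸ self_mem_traces _ _ _⟩))
    · exact mem_traces_mk.2 (Or.inr (Or.inr ⟨j, ih j (h.ask k j) hj⟩))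

theorem Asks.traces_injective (h : Asks T W p Γ S) {t t' : NF V Γ S}
    (ht : traces t W p = traces t' W p) : t = t' := by
  induction t generalizing W p with
  | mk Γ S k hk args ih =>
    obtain ⟨_, _, k', hk', args'⟩ := t'
    have ha : answer W p S k ∈ traces (NF.mk Γ S k' hk' args') W p :=
      ht ▸ mem_traces_mk.2 (Or.inr (Or.inl rfl))
    obtain rfl : k = k' := by
      refine h.answer_injective ?_
      rcases mem_traces_mk.1 ha with ha | ha | ⟨j, ha⟩
      · simp [answer] at ha
      · exact ha
      · have := (prefix_of_mem_traces _ ha).length_le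
        rw [length_ask, length_answer] at this
        omega
    congr 1
    funext j
    refine ih j (h.ask k j) (Set.Subset.antisymm (fun r hr => ?_) fun r hr => ?_)
    · exact mem_traces_arg (hk := hk') (ht ▸ mem_traces_mk.2 (Or.inr (Or.inr ⟨j, hr⟩)))
        (prefix_of_mem_traces _ hr)
    · exact mem_traces_arg (hk := hk) (ht ▸ mem_traces_mk.2 (Or.inr (Or.inr ⟨j, hr⟩)))
        (prefix_of_mem_traces _ hr)

theorem IsGame.mem_of_prefix {M : Type} {σ : Set (List M)} (h : IsGame σ) {p q : List M}
    (hq : q ∈ σ) (hp : p <+: q) : p ∈ σ := by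
  obtain ⟨s, rfl⟩ := hp
  induction s using List.reverseRecOn with
  | nil => simpa using hq
  | append_singleton s m ih =>
    refine ih ?_
    have := h.2 _ hq (by simp)
    rwa [← List.append_assoc, List.dropLast_concat] at this

theorem Asks.exists_traces_eq {σ : Set (List (ℕ × ℕ))}
    (hσ : IsStrategy (PG (gameOf (tyTrans T) none)) σ)
    (hlive : Live (PG (gameOf (tyTrans T) none)) σ) (hcopy : CopycatStrategy T σ) {N : ℕ}
    (hN : ∀ r ∈ σ, r.length ≤ N) (n : ℕ) (h : Asks T W p Γ S) (hp : p ∈ σ)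
    (hn : N < p.length + n) : ∃ t : NF V Γ S, traces t W p = {r | r ∈ σ ∧ p <+: r} := by
  induction n generalizing W p Γ S with
  | zero => exact absurd (hN p hp) (by omega)
  | succ n ih =>
    obtain ⟨hsub, hgame, hresp⟩ := hσ
    obtain ⟨m, hm, hu⟩ := hresp p hp h.odd
    obtain ⟨k, hk⟩ := h.eq_answer (hsub hm)
    have ha : answer W p S k ∈ σ := hk ▸ hm
    have hask (j : Fin ((Γ ++ S.branches).get k).branches.length) :
        Hypergames.ask W p S k j ∈ σ :=
      hlive _ ha (by rw [length_answer]; exact h.odd.add_one) _ (h.ask k j).mem_PG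
    choose args hargs using fun j => ih (h.ask k j) (hask j) (by rw [length_ask]; omega)
    refine ⟨NF.mk Γ S k ((h.copycat_answer k).1 (hcopy _ ha)).2 args, Set.ext fun r => ?_⟩
    rw [mem_traces_mk]
    constructor
    · rintro (rfl | rfl | ⟨j, hj⟩)
      · exact ⟨hp, List.prefix_rfl⟩
      · exact ⟨ha, prefix_answer ..⟩
      · rw [hargs] at hj
        exact ⟨hj.1, (prefix_answer ..).trans ((answer_prefix_ask ..).trans hj.2)⟩
    · rintro ⟨hr, s, rfl⟩
      cases s with
      | nil => simp
      | cons m' s =>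
        obtain rfl : m' = m := hu m' (hgame.mem_of_prefix hr ⟨s, by simp⟩)
        cases s with
        | nil => exact Or.inr (Or.inl hk)
        | cons o s =>
          have ho : answer W p S k ++ [o] <+: p ++ m' :: o :: s := ⟨s, by simp [← hk]⟩
          obtain ⟨j, hj⟩ := h.eq_ask k (hsub (hgame.mem_of_prefix hr ho))
          refine Or.inr (Or.inr ⟨j, ?_⟩)
          rw [hargs]
          exact ⟨hr, hj ▸ ho⟩

end Strategy

theorem asks_start {V : Type} (T : Ty V) : Asks T [] [(0, 1)] [] T := by
  refine ⟨[], (run_concat T [] 0 1 [] T).2 ⟨run_nil T, ?_⟩, by simp, rfl, List.nodup_nil, ?_⟩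
  · simp [stateAt, tyTrans]
  · simp [VarOf]

theorem eq_of_singleton_mem_PG {V : Type} {T : Ty V} {m : ℕ × ℕ}
    (h : [m] ∈ PG (gameOf (tyTrans T) none)) : m = (0, 1) := by
  obtain ⟨L, hL⟩ := mem_PG_iff.1 h
  obtain ⟨hα, -, -, hi⟩ := hL.2 0 m.1 m.2 rfl
  obtain ⟨α, i⟩ := m
  obtain rfl : α = 0 := by simpa using hα
  by_cases h1 : i = 1
  · rw [h1]
  · simp [stateAt, tyTrans, h1] at hi

theorem copycatDialogue_of_length_le_one {V : Type} (T : Ty V) {d : List (ℕ × ℕ)}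
    (hd : d.length ≤ 1) : CopycatDialogue T d := fun j _ h2 hj => by omega

/-- The strategy denoted by a closed term. -/
def strategyOf {V : Type} {T : Ty V} (t : NF V [] T) : Set (List (ℕ × ℕ)) :=
  insert [] (traces t [] [(0, 1)])

theorem nil_notMem_traces {V : Type} {T : Ty V} (t : NF V [] T) :
    [] ∉ traces t [] [(0, 1)] := fun h => by
  simpa using prefix_of_mem_traces t h

theorem isStrategy_strategyOf {V : Type} {T : Ty V} (t : NF V [] T) :
    IsStrategy (PG (gameOf (tyTrans T) none)) (strategyOf t) := by
  have hs := asks_start T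
  refine ⟨?_, ⟨Set.mem_insert _ _, fun r hr hne => ?_⟩, fun r hr hodd => ?_⟩
  · exact Set.insert_subset (mem_PG_iff.2 ⟨[], run_nil T⟩) (hs.traces_subset t)
  · have hr := hr.resolve_left hne
    by_cases h1 : r = [(0, 1)]
    · exact Or.inl (by simp [h1])
    · exact Or.inr (dropLast_mem_traces t hr h1)
  · have hr : r ∈ traces t [] [(0, 1)] := hr.resolve_left (by rintro rfl; simp at hodd)
    obtain ⟨m, hm, hu⟩ := hs.existsUnique_mem_traces t hr hodd
    exact ⟨m, Or.inr hm, fun m' hm' => hu m' (hm'.resolve_left (by simp))⟩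

theorem live_strategyOf {V : Type} {T : Ty V} (t : NF V [] T) :
    Live (PG (gameOf (tyTrans T) none)) (strategyOf t) := by
  rintro r (rfl | hr) heven m hm
  · obtain rfl := eq_of_singleton_mem_PG hm
    exact Or.inr (self_mem_traces t _ _)
  · exact Or.inr ((asks_start T).live_traces t hr heven hm)

theorem copycat_strategyOf {V : Type} {T : Ty V} (t : NF V [] T) :
    CopycatStrategy T (strategyOf t) := by
  rintro r (rfl | hr)
  · exact copycatDialogue_of_length_le_one T (by simp)
  · exact (asks_start T).copycat_of_mem_traces (copycatDialogue_of_length_le_one T (by simp)) t hr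

theorem strategyOf_injective {V : Type} {T : Ty V} :
    Function.Injective (strategyOf : NF V [] T → Set (List (ℕ × ℕ))) := fun t t' h => by
  refine (asks_start T).traces_injective ?_
  rw [← Set.insert_sdiff_self_of_notMem (nil_notMem_traces t),
    ← Set.insert_sdiff_self_of_notMem (nil_notMem_traces t')]
  exact congrArg (· \ {[]}) h

theorem exists_strategyOf_eq {V : Type} {T : Ty V} {σ : Set (List (ℕ × ℕ))}
    (hσ : IsStrategy (PG (gameOf (tyTrans T) none)) σ)
    (hlive : Live (PG (gameOf (tyTrans T) none)) σ) (hfin : σ.Finite)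
    (hcopy : CopycatStrategy T σ) : ∃ t : NF V [] T, strategyOf t = σ := by
  have hs := asks_start T
  obtain ⟨N, hN⟩ := (hfin.image List.length).bddAbove
  have hstart : [(0, 1)] ∈ σ := hlive [] hσ.2.1.1 (by simp) (0, 1) hs.mem_PG
  obtain ⟨t, ht⟩ := hs.exists_traces_eq hσ hlive hcopy
    (fun r hr => hN (Set.mem_image_of_mem _ hr)) (N + 1) hstart (by omega)
  refine ⟨t, Set.ext fun r => ?_⟩
  rw [strategyOf, ht]
  constructor
  · rintro (rfl | hr)
    · exact hσ.2.1.1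
    · exact hr.1
  · intro hr
    cases r with
    | nil => exact Or.inl rfl
    | cons m s =>
      obtain rfl := eq_of_singleton_mem_PG (T := T) (m := m)
        (mem_PG_of_append (d' := s) (by simpa using hσ.1 hr))
      exact Or.inr ⟨hr, s, rfl⟩

/-- Let `T` be a simple type generated from a set `Var` of
type variables by implication `→`.  The η-expanded β-normal closed λ-terms of
type `T` are in bijection with the finite live strategies on the
`P`-backtracking game `𝒫G(Δ_T)` which satisfy the copycat condition. -/
theorem etaBetaNormal_equiv_finiteLiveCopycatStrategies
    (Var : Type) (T : Ty Var) :
    Nonempty (NF Var [] T ≃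
      { σ : Set (List (ℕ × ℕ)) //
          IsStrategy (PG (gameOf (tyTrans T) none)) σ ∧
          Live (PG (gameOf (tyTrans T) none)) σ ∧
          σ.Finite ∧
          CopycatStrategy T σ }) := by
  refine ⟨Equiv.ofBijective (fun t => ⟨strategyOf t, isStrategy_strategyOf t, live_strategyOf t,
    (traces_finite t _ _).insert _, copycat_strategyOf t⟩) ⟨fun t t' h => ?_, ?_⟩⟩
  · exact strategyOf_injective (Subtype.ext_iff.1 h)
  · rintro ⟨σ, hσ, hlive, hfin, hcopy⟩
    obtain ⟨t, ht⟩ := exists_strategyOf_eq hσ hlive hfin hcopy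
    exact ⟨t, Subtype.ext ht⟩

end Hypergames
end
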